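/- Let T = X + iY satisfy assumption (A) and fix φ either in C¹₁([a,b]) or a polynomial. Then there exists a unique function η(φ; ·) ∈ L¹([a,b]) such that for every ψ in the same class, −i Tr([ψ(Y), φ(X)]) = ∫_a^b ψ′(λ) η(φ; λ) dλ. Moreover ∫_a^b |η(φ; λ)| dλ ≤ ‖−i[Y, φ(X)]‖₁ and ∫_a^b η(φ; λ) dλ = Tr(φ′(X) D²); and if φ′ ≥ 0 on [a,b], then η(φ; λ) ≥ 0 for almost all λ ∈ [a,b]. -/

import Mathlib

open scoped InnerProductSpace
open MeasureTheory Polynomial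

namespace HHCP

variable {H : Type*} [NormedAddCommGroup H] [InnerProductSpace ℂ H] [CompleteSpace H]
  [TopologicalSpace.SeparableSpace H]

/-- `f(A)` for a function `f` of a real variable, applied to the (selfadjoint, hence
star-normal) bounded operator `A` via the continuous functional calculus. -/
noncomputable def fc (f : ℝ → ℂ) (A : H →L[ℂ] H) : H →L[ℂ] H :=
  cfc (fun z : ℂ => f z.re) A

/-- `|A| = √(A⋆A)`. -/
noncomputable def absOp (A : H →L[ℂ] H) : H →L[ℂ] H :=
  cfc Real.sqrt (ContinuousLinearMap.adjoint A * A)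

/-- `A` is of trace class, i.e. `∑ ⟪eᵢ, |A| eᵢ⟫ < ∞` (this is independent of the
choice of the Hilbert basis `e`). -/
def IsTraceClass {ι : Type*} (e : HilbertBasis ι ℂ H) (A : H →L[ℂ] H) : Prop :=
  Summable fun i => (⟪e i, absOp A (e i)⟫_ℂ).re

/-- The trace norm `‖A‖₁ = Tr |A|`. -/
noncomputable def traceNorm {ι : Type*} (e : HilbertBasis ι ℂ H) (A : H →L[ℂ] H) : ℝ :=
  ∑' i, (⟪e i, absOp A (e i)⟫_ℂ).re

/-- The trace `Tr A = ∑ᵢ ⟪eᵢ, A eᵢ⟫`. -/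
noncomputable def trace {ι : Type*} (e : HilbertBasis ι ℂ H) (A : H →L[ℂ] H) : ℂ :=
  ∑' i, ⟪e i, A (e i)⟫_ℂ

/-- `T` is hyponormal (`‖T⋆x‖ ≤ ‖Tx‖`, i.e. `[T⋆,T] ≥ 0`) and *purely* so: there is no
nonzero closed subspace, invariant under `T` and `T⋆`, on which `T` is normal. -/
def PurelyHyponormal (T : H →L[ℂ] H) : Prop :=
  (∀ x : H, ‖ContinuousLinearMap.adjoint T x‖ ≤ ‖T x‖) ∧
  ∀ S : Submodule ℂ H, IsClosed (S : Set H) →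
    (∀ x ∈ S, T x ∈ S) → (∀ x ∈ S, ContinuousLinearMap.adjoint T x ∈ S) →
    (∀ x ∈ S, ‖T x‖ = ‖ContinuousLinearMap.adjoint T x‖) → S = ⊥

/-- Assumption (A): `T = X + iY` is purely hyponormal with `X, Y` selfadjoint,
`[T⋆,T] = −2i[Y,X] = 2D²` is a positive trace-class operator, and
`σ(X) ∪ σ(Y) ⊆ [a,b]`. -/
structure AssumptionA {ι : Type*} (e : HilbertBasis ι ℂ H)
    (X Y D2 : H →L[ℂ] H) (a b : ℝ) : Prop where
  hab : a ≤ b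
  hX : IsSelfAdjoint X
  hY : IsSelfAdjoint Y
  hpure : PurelyHyponormal (X + Complex.I • Y)
  hD2 : (2 : ℂ) • D2 = (-(2 : ℂ) * Complex.I) • (Y * X - X * Y)
  hpos : D2.IsPositive
  htc : IsTraceClass e D2
  hspecX : spectrum ℝ X ⊆ Set.Icc a b
  hspecY : spectrum ℝ Y ⊆ Set.Icc a b

/-- `ψ ∈ C¹₁`: `ψ(β) = (2π)^{-1/2} ∫ ψ̂(α) e^{iαβ} dα` for some `ψ̂` with
`∫ |ψ̂(α)|(1+|α|) dα < ∞`. -/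
def MemC11 (ψ : ℝ → ℂ) : Prop :=
  ∃ g : ℝ → ℂ, Integrable g ∧ Integrable (fun α : ℝ => α • g α) ∧
    ∀ β : ℝ, ψ β = (Real.sqrt (2 * Real.pi))⁻¹ •
      ∫ α : ℝ, Complex.exp (Complex.I * (α : ℂ) * (β : ℂ)) • g α

/-- `ψ` is (the function given by) a polynomial with complex coefficients. -/
def IsPolyFun (ψ : ℝ → ℂ) : Prop :=
  ∃ p : Polynomial ℂ, ∀ t : ℝ, ψ t = Polynomial.eval (t : ℂ) p

/-- `ψ` is either in `C¹₁([a,b])` or a polynomial. -/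
def GoodFun (ψ : ℝ → ℂ) : Prop := MemC11 ψ ∨ IsPolyFun ψ

/-- `E` is the spectral measure of the selfadjoint operator `A`: a projection-valued,
countably additive measure on `ℝ` such that `⟪x, f(A) x⟫ = ∫ f dμ_x`, where `μ_x` is the
finite positive measure `μ_x(Δ) = ⟪x, E(Δ) x⟫`. -/
def IsSpectralMeasureOf (A : H →L[ℂ] H) (E : Set ℝ → H →L[ℂ] H) : Prop :=
  (∀ Δ : Set ℝ, IsSelfAdjoint (E Δ)) ∧
  (∀ Δ Ω : Set ℝ, E (Δ ∩ Ω) = E Δ * E Ω) ∧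
  E Set.univ = 1 ∧
  (∀ Δ : ℕ → Set ℝ, (∀ n, MeasurableSet (Δ n)) → Pairwise (Function.onFun Disjoint Δ) →
    ∀ x : H, HasSum (fun n => E (Δ n) x) (E (⋃ n, Δ n) x)) ∧
  ∀ x : H, ∃ μ : Measure ℝ, IsFiniteMeasure μ ∧
    (∀ Δ : Set ℝ, MeasurableSet Δ → (μ Δ).toReal = (⟪x, E Δ x⟫_ℂ).re) ∧
    ∀ f : ℝ → ℝ, Continuous f → (⟪x, cfc f A x⟫_ℂ).re = ∫ t, f t ∂μ

/-- An indefinite integral `𝒥(χ_Δ)` of the characteristic function of `Δ`. -/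
noncomputable def Jind (a : ℝ) (Δ : Set ℝ) (t : ℝ) : ℝ :=
  ∫ s in a..t, Set.indicator Δ (fun _ => (1 : ℝ)) s

/-- `𝒥(χ_Δ)(A)`. -/
noncomputable def JindOp (a : ℝ) (Δ : Set ℝ) (A : H →L[ℂ] H) : H →L[ℂ] H :=
  fc (fun t => (Jind a Δ t : ℂ)) A

/-- `ψ ∈ C¹([a,b])` with derivative `ψd` on `[a,b]`. -/
def HasDerivOnIcc (ψ ψd : ℝ → ℂ) (a b : ℝ) : Prop :=
  (∀ t ∈ Set.Icc a b, HasDerivWithinAt ψ (ψd t) (Set.Icc a b) t) ∧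
  ContinuousOn ψd (Set.Icc a b)

/-- `r` is a Carey–Pincus principal function for the pair `X, Y`: a nonnegative
`L¹([a,b]²)` function with `Tr(−i[ψ(Y), φ(X)]) = ∫∫ φ′(t) ψ′(λ) r(t,λ) dt dλ`
for all `ψ, φ ∈ C¹([a,b])`. -/
def IsPrincipalFunction {ι : Type*} (e : HilbertBasis ι ℂ H) (X Y : H →L[ℂ] H)
    (a b : ℝ) (r : ℝ → ℝ → ℝ) : Prop :=
  IntegrableOn (fun q : ℝ × ℝ => r q.1 q.2) (Set.Icc a b ×ˢ Set.Icc a b) ∧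
  (∀ᵐ q : ℝ × ℝ ∂(volume : Measure (ℝ × ℝ)),
    q ∈ Set.Icc a b ×ˢ Set.Icc a b → 0 ≤ r q.1 q.2) ∧
  ∀ ψ ψd φ φd : ℝ → ℂ, HasDerivOnIcc ψ ψd a b → HasDerivOnIcc φ φd a b →
    trace e ((-Complex.I) • (fc ψ Y * fc φ X - fc φ X * fc ψ Y)) =
      ∫ t in Set.Icc a b, ∫ l in Set.Icc a b, φd t * ψd l * (r t l : ℂ)

/-- The Jacobian `J(F,G)(t,λ) = ∂F/∂t ∂G/∂λ − ∂F/∂λ ∂G/∂t`. -/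
noncomputable def Jac (F G : ℝ → ℝ → ℂ) (t l : ℝ) : ℂ :=
  deriv (fun s => F s l) t * deriv (fun s => G t s) l -
    deriv (fun s => F t s) l * deriv (fun s => G s l) t


open scoped ENNReal
open ContinuousLinearMap (adjoint)

/-! ### Hilbert-Schmidt and trace class operators -/

/-- Square of the Hilbert-Schmidt norm. -/
noncomputable def hs {ι : Type*} (e : HilbertBasis ι ℂ H) (A : H →L[ℂ] H) : ℝ≥0∞ :=
  ∑' i, ‖A (e i)‖ₑ ^ 2

/-- The trace norm, as a supremum over contractions. -/
noncomputable def nuc {ι : Type*} (e : HilbertBasis ι ℂ H) (A : H →L[ℂ] H) : ℝ≥0∞ :=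
  ⨆ (W : H →L[ℂ] H) (_ : ‖W‖ ≤ 1), ∑' i, ‖⟪e i, W (A (e i))⟫_ℂ‖ₑ

lemma parseval_enorm {ι : Type*} (e : HilbertBasis ι ℂ H) (x : H) :
    ∑' i, ‖⟪e i, x⟫_ℂ‖ₑ ^ 2 = ‖x‖ₑ ^ 2 := by
  have h := e.hasSum_inner_mul_inner x x
  have h2 : HasSum (fun i => ‖⟪e i, x⟫_ℂ‖ ^ 2) (‖x‖ ^ 2) := by
    have := (Complex.hasSum_re h)
    rw [← inner_self_eq_norm_sq (𝕜 := ℂ) x]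
    convert! this using 1
    ext i
    rw [← inner_conj_symm x (e i), Complex.conj_mul']
    norm_cast
  have h3 := ENNReal.ofReal_tsum_of_nonneg (fun i => by positivity) h2.summable
  rw [h2.tsum_eq] at h3
  simp only [ENNReal.ofReal_pow (norm_nonneg _), ofReal_norm] at h3
  exact h3.symm

lemma hs_adjoint {ι : Type*} (e : HilbertBasis ι ℂ H) (A : H →L[ℂ] H) :
    hs e (adjoint A) = hs e A := by
  unfold hs
  simp_rw [← parseval_enorm e]
  rw [ENNReal.tsum_comm]
  refine tsum_congr fun i => tsum_congr fun j => ?_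
  rw [ContinuousLinearMap.adjoint_inner_right, ← inner_conj_symm, RCLike.enorm_conj]

lemma hs_mul_left {ι : Type*} (e : HilbertBasis ι ℂ H) (W A : H →L[ℂ] H) :
    hs e (W * A) ≤ ‖W‖ₑ ^ 2 * hs e A := by
  unfold hs
  rw [← ENNReal.tsum_mul_left]
  refine ENNReal.tsum_le_tsum fun i => ?_
  rw [← mul_pow]
  gcongr
  exact W.le_opENorm _

lemma hs_mul_right {ι : Type*} (e : HilbertBasis ι ℂ H) (A W : H →L[ℂ] H) :
    hs e (A * W) ≤ ‖W‖ₑ ^ 2 * hs e A := by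
  rw [← hs_adjoint e (A * W), ← hs_adjoint e A]
  have : adjoint (A * W) = adjoint W * adjoint A := star_mul A W
  rw [this]
  refine (hs_mul_left e _ _).trans ?_
  have : ‖adjoint W‖ₑ = ‖W‖ₑ := by
    rw [← ofReal_norm, ← ofReal_norm, LinearIsometryEquiv.norm_map]
  rw [this]

lemma tsum_inner_le {ι : Type*} (e : HilbertBasis ι ℂ H) (S T : H →L[ℂ] H) :
    ∑' i, ‖⟪S (e i), T (e i)⟫_ℂ‖ₑ ≤ hs e S ^ (1 / 2 : ℝ) * hs e T ^ (1 / 2 : ℝ) := by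
  rw [ENNReal.tsum_eq_iSup_sum]
  refine iSup_le fun s => ?_
  have h1 : ∀ i, ‖⟪S (e i), T (e i)⟫_ℂ‖ₑ ≤ ‖S (e i)‖ₑ * ‖T (e i)‖ₑ := by
    intro i
    simp only [← ofReal_norm]
    rw [← ENNReal.ofReal_mul (norm_nonneg _)]
    exact ENNReal.ofReal_le_ofReal (norm_inner_le_norm _ _)
  refine (Finset.sum_le_sum fun i _ => h1 i).trans ?_
  refine (ENNReal.inner_le_Lp_mul_Lq s _ _ Real.HolderConjugate.two_two).trans ?_
  unfold hs
  have h2 : ∀ x : ℝ≥0∞, x ^ (2 : ℝ) = x ^ 2 := fun x => by norm_cast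
  simp only [h2]
  gcongr <;> exact ENNReal.sum_le_tsum s

lemma nuc_le_of_hs {ι : Type*} (e : HilbertBasis ι ℂ H) (S T : H →L[ℂ] H) :
    nuc e (adjoint S * T) ≤ hs e S ^ (1 / 2 : ℝ) * hs e T ^ (1 / 2 : ℝ) := by
  unfold nuc
  refine iSup₂_le fun W hW => ?_
  have h1 : ∀ i, ⟪e i, W ((adjoint S * T) (e i))⟫_ℂ = ⟪(S * adjoint W) (e i), T (e i)⟫_ℂ := by
    intro i
    simp only [mul_apply_eq_comp]
    rw [← ContinuousLinearMap.adjoint_inner_left, ContinuousLinearMap.adjoint_inner_right]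
  simp_rw [h1]
  refine (tsum_inner_le e _ _).trans ?_
  gcongr
  refine (hs_mul_right e _ _).trans ?_
  have : ‖adjoint W‖ₑ ≤ 1 := by
    rw [← ofReal_norm, LinearIsometryEquiv.norm_map]
    exact ENNReal.ofReal_le_one.2 hW
  calc _ ≤ (1 : ℝ≥0∞) ^ 2 * hs e S := by gcongr
    _ = _ := by simp

lemma absOp_sa (A : H →L[ℂ] H) : 0 ≤ absOp A := by
  unfold absOp
  exact cfc_nonneg fun x _ => Real.sqrt_nonneg x

lemma absOp_sq (A : H →L[ℂ] H) : absOp A * absOp A = adjoint A * A := by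
  unfold absOp
  have h0 : (0 : H →L[ℂ] H) ≤ adjoint A * A := star_mul_self_nonneg A
  rw [← cfc_mul _ _ _ (Real.continuous_sqrt.continuousOn) (Real.continuous_sqrt.continuousOn)]
  conv_rhs => rw [← cfc_id' ℝ (adjoint A * A) (ha := .of_nonneg h0)]
  refine cfc_congr fun x hx => ?_
  exact Real.mul_self_sqrt (spectrum_nonneg_of_nonneg h0 hx)

lemma norm_absOp (A : H →L[ℂ] H) (x : H) : ‖absOp A x‖ = ‖A x‖ := by
  have hsa : adjoint (absOp A) = absOp A := (IsSelfAdjoint.of_nonneg (absOp_sa A)).star_eq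
  have h : ⟪absOp A x, absOp A x⟫_ℂ = ⟪A x, A x⟫_ℂ := by
    rw [← ContinuousLinearMap.adjoint_inner_right, hsa, ← ContinuousLinearMap.adjoint_inner_right]
    change ⟪x, (absOp A * absOp A) x⟫_ℂ = ⟪x, (adjoint A * A) x⟫_ℂ
    rw [absOp_sq]
  rw [inner_self_eq_norm_sq_to_K, inner_self_eq_norm_sq_to_K] at h
  have h' : ‖absOp A x‖ ^ 2 = ‖A x‖ ^ 2 := by exact_mod_cast h
  exact (pow_left_inj₀ (norm_nonneg _) (norm_nonneg _) two_ne_zero).1 h'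

lemma exists_polar (A : H →L[ℂ] H) :
    ∃ W : H →L[ℂ] H, ‖W‖ ≤ 1 ∧ A = W * absOp A ∧ absOp A = adjoint W * A := by
  set P := absOp A with hP
  let R : Submodule ℂ H := LinearMap.range P.toLinearMap
  have hex : ∀ y : R, ∃ x, P x = y := fun y => y.2
  choose g hg using hex
  have hA : ∀ x x', P x = P x' → A x = A x' := by
    intro x x' h
    have : ‖A (x - x')‖ = 0 := by
      rw [← norm_absOp, map_sub, ← hP, h, sub_self, norm_zero]
    rw [norm_eq_zero, map_sub, sub_eq_zero] at this
    exact this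
  let f0 : R →ₗ[ℂ] H :=
    { toFun := fun y => A (g y)
      map_add' := fun y z => by
        rw [← map_add]; apply hA; rw [map_add, hg, hg, hg]; rfl
      map_smul' := fun c y => by
        rw [RingHom.id_apply, ← map_smul]; apply hA; rw [map_smul, hg, hg]; rfl }
  have hf0 : ∀ y, ‖f0 y‖ ≤ 1 * ‖y‖ := by
    intro y
    change ‖A (g y)‖ ≤ _
    rw [← norm_absOp, ← hP, hg, one_mul]; rfl
  let f : R →L[ℂ] H := f0.mkContinuous 1 hf0
  let K := R.topologicalClosure
  let i : R →L[ℂ] K := 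
    (Submodule.inclusion R.le_topologicalClosure).mkContinuous 1 (fun x => by rw [one_mul]; exact le_rfl)
  have hid : DenseRange i := by
    intro z
    have hz : (z : H) ∈ closure (R : Set H) := by
      have := z.2
      rwa [← SetLike.mem_coe, Submodule.topologicalClosure_coe] at this
    rw [mem_closure_iff_seq_limit] at hz
    obtain ⟨u, hu, hul⟩ := hz
    rw [mem_closure_iff_seq_limit]
    refine ⟨fun n => i ⟨u n, hu n⟩, fun n => ⟨_, rfl⟩, ?_⟩
    rw [tendsto_subtype_rng]
    exact hul
  have hin : ∀ x : R, ‖x‖ ≤ ((1 : NNReal) : ℝ) * ‖i x‖ := fun x => by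
    rw [NNReal.coe_one, one_mul]; exact le_rfl
  let E : K →L[ℂ] H := f.extend i
  have hE : ‖E‖ ≤ 1 := by
    refine (f.opNorm_extend_le (N := 1) hid hin).trans ?_
    rw [NNReal.coe_one, one_mul]
    exact f0.mkContinuous_norm_le zero_le_one hf0
  have hui : IsUniformInducing i := by
    have : Isometry i := AddMonoidHomClass.isometry_of_norm i (fun x => rfl)
    exact this.isUniformInducing
  have hEi : ∀ y, E (i y) = f y := fun y => f.extend_eq hid hui y
  have : CompleteSpace K := R.isClosed_topologicalClosure.completeSpace_coe
  let W : H →L[ℂ] H := E ∘L K.orthogonalProjectionOnto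
  have hW : ‖W‖ ≤ 1 := by
    refine (ContinuousLinearMap.opNorm_comp_le _ _).trans ?_
    exact mul_le_one₀ hE (norm_nonneg _) K.orthogonalProjectionOnto_norm_le
  have hWP : ∀ x, W (P x) = A x := by
    intro x
    have hx : P x ∈ R := ⟨x, rfl⟩
    have hxK : P x ∈ K := R.le_topologicalClosure hx
    change E (K.orthogonalProjectionOnto (P x)) = A x
    have : K.orthogonalProjectionOnto (P x) = i ⟨P x, hx⟩ :=
      Submodule.orthogonalProjectionOnto_mem_subspace_eq_self (K := K) ⟨P x, hxK⟩
    rw [this, hEi]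
    change A (g ⟨P x, hx⟩) = A x
    exact hA _ _ (hg _)
  refine ⟨W, hW, ?_, ?_⟩
  · ext x; exact (hWP x).symm
  · ext x
    change P x = adjoint W (A x)
    have h1 : ‖adjoint W (A x)‖ ≤ ‖A x‖ := by
      refine (ContinuousLinearMap.le_opNorm _ _).trans ?_
      have : ‖adjoint W‖ ≤ 1 := by simpa using hW
      exact mul_le_of_le_one_left (norm_nonneg _) this
    have h2 : (⟪P x, adjoint W (A x)⟫_ℂ).re = ‖A x‖ ^ 2 := by
      rw [ContinuousLinearMap.adjoint_inner_right, hWP]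
      exact inner_self_eq_norm_sq (𝕜 := ℂ) (A x)
    have h3 : ‖P x - adjoint W (A x)‖ ^ 2 ≤ 0 := by
      rw [norm_sub_sq (𝕜 := ℂ)]
      change _ - 2 * (⟪P x, adjoint W (A x)⟫_ℂ).re + _ ≤ 0
      rw [h2, norm_absOp]
      nlinarith [norm_nonneg (adjoint W (A x)), norm_nonneg (A x)]
    have h4 : ‖P x - adjoint W (A x)‖ = 0 := by
      have := norm_nonneg (P x - adjoint W (A x)); nlinarith
    exact sub_eq_zero.1 (norm_eq_zero.1 h4)

/-- positive square root -/
lemma exists_sqrt {P : H →L[ℂ] H} (hP : 0 ≤ P) :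
    ∃ S : H →L[ℂ] H, 0 ≤ S ∧ adjoint S = S ∧ S * S = P := by
  refine ⟨cfc Real.sqrt P, cfc_nonneg fun x _ => Real.sqrt_nonneg x, ?_, ?_⟩
  · exact (IsSelfAdjoint.of_nonneg (cfc_nonneg fun x _ => Real.sqrt_nonneg x)).star_eq
  · rw [← cfc_mul _ _ _ (Real.continuous_sqrt.continuousOn) (Real.continuous_sqrt.continuousOn)]
    conv_rhs => rw [← cfc_id' ℝ P (ha := .of_nonneg hP)]
    refine cfc_congr fun x hx => ?_
    exact Real.mul_self_sqrt (spectrum_nonneg_of_nonneg hP hx)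

lemma hs_sqrt {ι : Type*} (e : HilbertBasis ι ℂ H) {S P : H →L[ℂ] H} (hS : adjoint S = S)
    (hSS : S * S = P) : hs e S = ∑' i, ENNReal.ofReal (⟪e i, P (e i)⟫_ℂ).re := by
  unfold hs
  refine tsum_congr fun i => ?_
  rw [← hSS, mul_apply_eq_comp, ← ContinuousLinearMap.adjoint_inner_left, hS]
  have : (⟪S (e i), S (e i)⟫_ℂ).re = ‖S (e i)‖ ^ 2 := inner_self_eq_norm_sq (𝕜 := ℂ) _
  rw [this, ENNReal.ofReal_pow (norm_nonneg _), ofReal_norm]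

lemma tsum_absOp_le {ι : Type*} (e : HilbertBasis ι ℂ H) (A : H →L[ℂ] H) :
    ∑' i, ENNReal.ofReal (⟪e i, absOp A (e i)⟫_ℂ).re ≤ nuc e A := by
  obtain ⟨W, hW, h1, h2⟩ := exists_polar A
  refine le_trans ?_ (le_iSup₂_of_le (adjoint W) (by simpa using hW) le_rfl)
  refine ENNReal.tsum_le_tsum fun i => ?_
  rw [h2, ← ofReal_norm]
  exact ENNReal.ofReal_le_ofReal (Complex.re_le_norm _)

lemma exists_factor {ι : Type*} (e : HilbertBasis ι ℂ H) (A : H →L[ℂ] H) :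
    ∃ S T : H →L[ℂ] H, A = adjoint S * T ∧
      hs e S ≤ ∑' i, ENNReal.ofReal (⟪e i, absOp A (e i)⟫_ℂ).re ∧
      hs e T ≤ ∑' i, ENNReal.ofReal (⟪e i, absOp A (e i)⟫_ℂ).re := by
  obtain ⟨W, hW, h1, h2⟩ := exists_polar A
  obtain ⟨S, hS0, hS, hSS⟩ := exists_sqrt (absOp_sa A)
  refine ⟨S * adjoint W, S, ?_, ?_, ?_⟩
  · have : adjoint (S * adjoint W) = adjoint (adjoint W) * adjoint S := star_mul _ _
    rw [this, ContinuousLinearMap.adjoint_adjoint, hS, mul_assoc, hSS]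
    exact h1
  · rw [← hs_sqrt e hS hSS]
    refine (hs_mul_right e _ _).trans ?_
    have : ‖adjoint W‖ₑ ≤ 1 := by
      rw [← ofReal_norm, LinearIsometryEquiv.norm_map]
      exact ENNReal.ofReal_le_one.2 hW
    calc _ ≤ (1 : ℝ≥0∞) ^ 2 * hs e S := by gcongr
      _ = _ := by simp
  · rw [← hs_sqrt e hS hSS]

lemma half_mul_half (x : ℝ≥0∞) : x ^ (1 / 2 : ℝ) * x ^ (1 / 2 : ℝ) = x := by
  rw [← ENNReal.rpow_add_of_nonneg _ _ (by norm_num) (by norm_num)]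
  norm_num

lemma nuc_eq_tsum {ι : Type*} (e : HilbertBasis ι ℂ H) (A : H →L[ℂ] H) :
    nuc e A = ∑' i, ENNReal.ofReal (⟪e i, absOp A (e i)⟫_ℂ).re := by
  refine le_antisymm ?_ (tsum_absOp_le e A)
  obtain ⟨S, T, h, hS, hT⟩ := exists_factor e A
  conv_lhs => rw [h]
  refine (nuc_le_of_hs e S T).trans ?_
  conv_rhs => rw [← half_mul_half (∑' i, ENNReal.ofReal (⟪e i, absOp A (e i)⟫_ℂ).re)]
  gcongr

lemma inner_nonneg_re {P : H →L[ℂ] H} (hP : 0 ≤ P) (x : H) : 0 ≤ (⟪x, P x⟫_ℂ).re := by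
  rw [ContinuousLinearMap.nonneg_iff_isPositive] at hP
  exact hP.re_inner_nonneg_right x

lemma nuc_eq_traceNorm {ι : Type*} (e : HilbertBasis ι ℂ H) (A : H →L[ℂ] H) (h : nuc e A ≠ ∞) :
    nuc e A = ENNReal.ofReal (traceNorm e A) := by
  unfold traceNorm
  rw [nuc_eq_tsum] at h ⊢
  rw [ENNReal.ofReal_tsum_of_nonneg (fun i => inner_nonneg_re (absOp_sa A) _)]
  have := ENNReal.summable_toReal h
  refine this.congr fun i => ?_
  rw [ENNReal.toReal_ofReal (inner_nonneg_re (absOp_sa A) _)]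

lemma absOp_of_nonneg {P : H →L[ℂ] H} (hP : 0 ≤ P) : absOp P = P := by
  unfold absOp
  have hsa : adjoint P = P := (IsSelfAdjoint.of_nonneg hP).star_eq
  have hsa' : IsSelfAdjoint P := IsSelfAdjoint.of_nonneg hP
  rw [hsa]
  have h1 : P * P = cfc (fun x : ℝ => x * x) P := by
    rw [cfc_mul (fun x : ℝ => x) (fun x => x) P, cfc_id' ℝ P]
  rw [h1, ← cfc_comp Real.sqrt (fun x : ℝ => x * x) P hsa'
    (Real.continuous_sqrt.continuousOn) (by fun_prop)]
  conv_rhs => rw [← cfc_id' ℝ P]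
  refine cfc_congr fun x hx => ?_
  exact Real.sqrt_mul_self (spectrum_nonneg_of_nonneg hP hx)

lemma nuc_of_isTraceClass {ι : Type*} (e : HilbertBasis ι ℂ H) {A : H →L[ℂ] H}
    (h : IsTraceClass e A) : nuc e A ≠ ∞ := by
  rw [nuc_eq_tsum, ← ENNReal.ofReal_tsum_of_nonneg (fun i => inner_nonneg_re (absOp_sa A) _) h]
  exact ENNReal.ofReal_ne_top

lemma nuc_mul_left {ι : Type*} (e : HilbertBasis ι ℂ H) (B A : H →L[ℂ] H) :
    nuc e (B * A) ≤ ‖B‖ₑ * nuc e A := by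
  obtain ⟨S, T, h, hS, hT⟩ := exists_factor e A
  rw [← nuc_eq_tsum] at hS hT
  have : B * A = adjoint (S * adjoint B) * T := by
    have : adjoint (S * adjoint B) = adjoint (adjoint B) * adjoint S := star_mul _ _
    rw [this, ContinuousLinearMap.adjoint_adjoint, mul_assoc, ← h]
  rw [this]
  refine (nuc_le_of_hs e _ _).trans ?_
  have hB : ‖adjoint B‖ₑ = ‖B‖ₑ := by
    rw [← ofReal_norm, ← ofReal_norm, LinearIsometryEquiv.norm_map]
  calc _ ≤ (‖B‖ₑ ^ 2 * nuc e A) ^ (1 / 2 : ℝ) * nuc e A ^ (1 / 2 : ℝ) := by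
        gcongr
        refine (hs_mul_right e _ _).trans ?_
        rw [hB]; gcongr
    _ = _ := by
        rw [ENNReal.mul_rpow_of_nonneg _ _ (by norm_num), mul_assoc, half_mul_half, pow_two,
          ENNReal.mul_rpow_of_nonneg _ _ (by norm_num), half_mul_half]

lemma nuc_mul_right {ι : Type*} (e : HilbertBasis ι ℂ H) (A B : H →L[ℂ] H) :
    nuc e (A * B) ≤ nuc e A * ‖B‖ₑ := by
  obtain ⟨S, T, h, hS, hT⟩ := exists_factor e A
  rw [← nuc_eq_tsum] at hS hT
  conv_lhs => rw [h, mul_assoc]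
  refine (nuc_le_of_hs e _ _).trans ?_
  calc _ ≤ nuc e A ^ (1 / 2 : ℝ) * (‖B‖ₑ ^ 2 * nuc e A) ^ (1 / 2 : ℝ) := by
        gcongr
        refine (hs_mul_right e _ _).trans ?_
        gcongr
    _ = _ := by
        rw [ENNReal.mul_rpow_of_nonneg _ _ (by norm_num), mul_comm, mul_assoc, half_mul_half,
          pow_two, ENNReal.mul_rpow_of_nonneg _ _ (by norm_num), half_mul_half, mul_comm]

lemma nuc_add {ι : Type*} (e : HilbertBasis ι ℂ H) (A B : H →L[ℂ] H) :
    nuc e (A + B) ≤ nuc e A + nuc e B := by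
  refine iSup₂_le fun W hW => ?_
  calc ∑' i, ‖⟪e i, W ((A + B) (e i))⟫_ℂ‖ₑ
      ≤ ∑' i, (‖⟪e i, W (A (e i))⟫_ℂ‖ₑ + ‖⟪e i, W (B (e i))⟫_ℂ‖ₑ) := by
        refine ENNReal.tsum_le_tsum fun i => ?_
        rw [_root_.add_apply, map_add, inner_add_right]
        exact enorm_add_le _ _
    _ = _ := ENNReal.tsum_add
    _ ≤ _ := by
        gcongr
        · exact le_iSup₂_of_le W hW le_rfl
        · exact le_iSup₂_of_le W hW le_rfl

lemma nuc_smul {ι : Type*} (e : HilbertBasis ι ℂ H) (c : ℂ) (A : H →L[ℂ] H) :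
    nuc e (c • A) ≤ ‖c‖ₑ * nuc e A := by
  refine iSup₂_le fun W hW => ?_
  calc ∑' i, ‖⟪e i, W ((c • A) (e i))⟫_ℂ‖ₑ
      = ∑' i, (‖c‖ₑ * ‖⟪e i, W (A (e i))⟫_ℂ‖ₑ) := by
        refine tsum_congr fun i => ?_
        rw [_root_.smul_apply, map_smul, inner_smul_right, enorm_mul]
    _ = _ := ENNReal.tsum_mul_left
    _ ≤ _ := by
        gcongr
        exact le_iSup₂_of_le W hW le_rfl

/-- Trace class predicate used in the proofs. -/
def TC {ι : Type*} (e : HilbertBasis ι ℂ H) (A : H →L[ℂ] H) : Prop := nuc e A ≠ ∞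

section TCsec
variable {ι : Type*} {e : HilbertBasis ι ℂ H} {A B : H →L[ℂ] H}

lemma TC.add (hA : TC e A) (hB : TC e B) : TC e (A + B) :=
  ne_top_of_le_ne_top (ENNReal.add_ne_top.2 ⟨hA, hB⟩) (nuc_add e A B)

lemma TC.smul (c : ℂ) (hA : TC e A) : TC e (c • A) :=
  ne_top_of_le_ne_top (ENNReal.mul_ne_top enorm_ne_top hA) (nuc_smul e c A)

lemma TC.neg (hA : TC e A) : TC e (-A) := by
  have := hA.smul (-1 : ℂ)
  rwa [neg_one_smul] at this

lemma TC.sub (hA : TC e A) (hB : TC e B) : TC e (A - B) := by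
  rw [sub_eq_add_neg]; exact hA.add hB.neg

lemma TC.mul_left (B : H →L[ℂ] H) (hA : TC e A) : TC e (B * A) :=
  ne_top_of_le_ne_top (ENNReal.mul_ne_top enorm_ne_top hA) (nuc_mul_left e B A)

lemma TC.mul_right (hA : TC e A) (B : H →L[ℂ] H) : TC e (A * B) :=
  ne_top_of_le_ne_top (ENNReal.mul_ne_top hA enorm_ne_top) (nuc_mul_right e A B)

lemma TC.zero : TC e (0 : H →L[ℂ] H) := by
  have : nuc e (0 : H →L[ℂ] H) = 0 := by simp [nuc]
  unfold TC; rw [this]; exact ENNReal.zero_ne_top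

lemma tsum_enorm_le_nuc (e : HilbertBasis ι ℂ H) (A : H →L[ℂ] H) :
    ∑' i, ‖⟪e i, A (e i)⟫_ℂ‖ₑ ≤ nuc e A := by
  refine le_iSup₂_of_le (1 : H →L[ℂ] H) ContinuousLinearMap.norm_id_le ?_
  simp

lemma TC.summable (hA : TC e A) : Summable fun i => ⟪e i, A (e i)⟫_ℂ := by
  have := ne_top_of_le_ne_top hA (tsum_enorm_le_nuc e A)
  refine Summable.of_norm ?_
  have h := ENNReal.summable_toReal this
  simpa using h

lemma norm_trace_le (hA : TC e A) : ‖trace e A‖ ≤ (nuc e A).toReal := by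
  have h1 := ne_top_of_le_ne_top hA (tsum_enorm_le_nuc e A)
  have h2 := ENNReal.summable_toReal h1
  simp only [toReal_enorm] at h2
  refine (norm_tsum_le_tsum_norm h2).trans ?_
  refine le_trans (le_of_eq ?_) (ENNReal.toReal_mono hA (tsum_enorm_le_nuc e A))
  rw [ENNReal.tsum_toReal_eq (fun i => enorm_ne_top)]
  simp

lemma trace_add (hA : TC e A) (hB : TC e B) : trace e (A + B) = trace e A + trace e B := by
  unfold trace
  rw [← hA.summable.tsum_add hB.summable]
  refine tsum_congr fun i => ?_
  rw [_root_.add_apply, inner_add_right]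

lemma trace_smul (c : ℂ) (A : H →L[ℂ] H) : trace e (c • A) = c * trace e A := by
  unfold trace
  rw [← tsum_mul_left]
  refine tsum_congr fun i => ?_
  rw [_root_.smul_apply, inner_smul_right]

lemma trace_neg (A : H →L[ℂ] H) : trace e (-A) = - trace e A := by
  have := trace_smul (e := e) (-1 : ℂ) A
  simpa using this

lemma trace_sub (hA : TC e A) (hB : TC e B) : trace e (A - B) = trace e A - trace e B := by
  rw [sub_eq_add_neg, trace_add hA hB.neg, trace_neg, sub_eq_add_neg]

lemma hs_swap {S T : H →L[ℂ] H} (hS : hs e S ≠ ∞) (hT : hs e T ≠ ∞) :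
    ∑' i, ⟪S (e i), T (e i)⟫_ℂ = ∑' j, ⟪adjoint T (e j), adjoint S (e j)⟫_ℂ := by
  have key : ∀ R : H →L[ℂ] H, hs e R ≠ ∞ → Summable fun q : ι × ι => ‖⟪e q.2, R (e q.1)⟫_ℂ‖ ^ 2 := by
    intro R hR
    unfold hs at hR
    simp_rw [← parseval_enorm e] at hR
    rw [← ENNReal.tsum_prod (f := fun i j => ‖⟪e j, R (e i)⟫_ℂ‖ₑ ^ 2)] at hR
    have := ENNReal.summable_toReal hR
    simpa using this
  have hsum : Summable (Function.uncurry fun i j => ⟪S (e i), e j⟫_ℂ * ⟪e j, T (e i)⟫_ℂ) := by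
    refine Summable.of_norm ?_
    refine Summable.of_nonneg_of_le (fun _ => norm_nonneg _) ?_ ((key S hS).add (key T hT))
    rintro ⟨i, j⟩
    simp only [Function.uncurry_apply_pair, norm_mul]
    rw [norm_inner_symm]
    nlinarith [sq_nonneg (‖⟪e j, S (e i)⟫_ℂ‖ - ‖⟪e j, T (e i)⟫_ℂ‖),
      sq_nonneg ‖⟪e j, S (e i)⟫_ℂ‖, sq_nonneg ‖⟪e j, T (e i)⟫_ℂ‖]
  have h1 : ∀ i, ⟪S (e i), T (e i)⟫_ℂ = ∑' j, ⟪S (e i), e j⟫_ℂ * ⟪e j, T (e i)⟫_ℂ :=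
    fun i => (e.tsum_inner_mul_inner _ _).symm
  have h2 : ∀ j, ⟪adjoint T (e j), adjoint S (e j)⟫_ℂ =
      ∑' i, ⟪S (e i), e j⟫_ℂ * ⟪e j, T (e i)⟫_ℂ := by
    intro j
    rw [← e.tsum_inner_mul_inner]
    refine tsum_congr fun i => ?_
    rw [ContinuousLinearMap.adjoint_inner_left, ContinuousLinearMap.adjoint_inner_right, mul_comm]
  simp_rw [h1, h2]
  exact hsum.tsum_comm.symm

lemma trace_mul_comm (hA : TC e A) (B : H →L[ℂ] H) : trace e (A * B) = trace e (B * A) := by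
  obtain ⟨S, T, h, hS, hT⟩ := exists_factor e A
  rw [← nuc_eq_tsum] at hS hT
  have hS' := ne_top_of_le_ne_top hA hS
  have hT' := ne_top_of_le_ne_top hA hT
  have hTB : hs e (T * B) ≠ ∞ :=
    ne_top_of_le_ne_top (ENNReal.mul_ne_top (by simp) hT') (hs_mul_right e T B)
  have hSB : hs e (S * adjoint B) ≠ ∞ :=
    ne_top_of_le_ne_top (ENNReal.mul_ne_top (by simp) hS') (hs_mul_right e S (adjoint B))
  have e1 : trace e (A * B) = ∑' i, ⟪S (e i), (T * B) (e i)⟫_ℂ := by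
    unfold trace
    refine tsum_congr fun i => ?_
    rw [h]
    simp only [mul_apply_eq_comp]
    rw [ContinuousLinearMap.adjoint_inner_right]
  have e2 : trace e (B * A) = ∑' i, ⟪(S * adjoint B) (e i), T (e i)⟫_ℂ := by
    unfold trace
    refine tsum_congr fun i => ?_
    rw [h]
    simp only [mul_apply_eq_comp]
    rw [← ContinuousLinearMap.adjoint_inner_left, ContinuousLinearMap.adjoint_inner_right]
  rw [e1, e2, hs_swap hS' hTB, hs_swap hSB hT']
  refine tsum_congr fun j => ?_
  have a1 : adjoint (T * B) = adjoint B * adjoint T := star_mul _ _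
  have a2 : adjoint (S * adjoint B) = adjoint (adjoint B) * adjoint S := star_mul _ _
  rw [a1, a2, ContinuousLinearMap.adjoint_adjoint]
  simp only [mul_apply_eq_comp]
  rw [ContinuousLinearMap.adjoint_inner_left]

lemma trace_adjoint (A : H →L[ℂ] H) : trace e (adjoint A) = (starRingEnd ℂ) (trace e A) := by
  unfold trace
  rw [Complex.conj_tsum]
  refine tsum_congr fun i => ?_
  rw [ContinuousLinearMap.adjoint_inner_right, inner_conj_symm]

/-- Trace of a product of positive operators is nonnegative. -/
lemma trace_mul_nonneg {Z P : H →L[ℂ] H} (hZ : 0 ≤ Z) (hP : 0 ≤ P) (hT : TC e P) :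
    0 ≤ (trace e (Z * P)).re := by
  obtain ⟨S, hS0, hS, hSS⟩ := exists_sqrt hZ
  have h1 : trace e (Z * P) = trace e (S * P * S) := by
    rw [trace_mul_comm (hT.mul_left S) S, ← mul_assoc, hSS]
  have h2 : 0 ≤ S * P * S := by
    have := star_right_conjugate_nonneg hP S
    rwa [show star S = S from hS] at this
  rw [h1]
  unfold trace
  rw [Complex.re_tsum ((hT.mul_left S).mul_right S).summable]
  exact tsum_nonneg fun i => inner_nonneg_re h2 _

end TCsec

/-! ### Functional calculus -/

section fcsec
variable {A : H →L[ℂ] H} {a b : ℝ}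

lemma spec_re (hA : IsSelfAdjoint A) (hs : spectrum ℝ A ⊆ Set.Icc a b) {z : ℂ}
    (hz : z ∈ spectrum ℂ A) : z.re ∈ Set.Icc a b ∧ z = (z.re : ℂ) := by
  refine ⟨hs ?_, hA.mem_spectrum_eq_re hz⟩
  have h2 := hA.mem_spectrum_eq_re hz
  rw [h2] at hz
  exact (spectrum.algebraMap_mem_iff ℂ).1 hz

lemma contOn_spec (hA : IsSelfAdjoint A) (hs : spectrum ℝ A ⊆ Set.Icc a b) {f : ℝ → ℂ}
    (hf : ContinuousOn f (Set.Icc a b)) : ContinuousOn (fun z : ℂ => f z.re) (spectrum ℂ A) :=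
  hf.comp Complex.continuous_re.continuousOn fun _ hz => (spec_re hA hs hz).1

lemma fc_congr (hA : IsSelfAdjoint A) (hs : spectrum ℝ A ⊆ Set.Icc a b) {f g : ℝ → ℂ}
    (h : Set.EqOn f g (Set.Icc a b)) : fc f A = fc g A :=
  cfc_congr fun _ hz => h (spec_re hA hs hz).1

lemma fc_add (hA : IsSelfAdjoint A) (hs : spectrum ℝ A ⊆ Set.Icc a b) {f g : ℝ → ℂ}
    (hf : ContinuousOn f (Set.Icc a b)) (hg : ContinuousOn g (Set.Icc a b)) :
    fc (fun x => f x + g x) A = fc f A + fc g A :=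
  cfc_add _ _ _ (contOn_spec hA hs hf) (contOn_spec hA hs hg)

lemma fc_sub (hA : IsSelfAdjoint A) (hs : spectrum ℝ A ⊆ Set.Icc a b) {f g : ℝ → ℂ}
    (hf : ContinuousOn f (Set.Icc a b)) (hg : ContinuousOn g (Set.Icc a b)) :
    fc (fun x => f x - g x) A = fc f A - fc g A :=
  cfc_sub _ _ _ (contOn_spec hA hs hf) (contOn_spec hA hs hg)

lemma fc_mul (hA : IsSelfAdjoint A) (hs : spectrum ℝ A ⊆ Set.Icc a b) {f g : ℝ → ℂ}
    (hf : ContinuousOn f (Set.Icc a b)) (hg : ContinuousOn g (Set.Icc a b)) :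
    fc (fun x => f x * g x) A = fc f A * fc g A :=
  cfc_mul _ _ _ (contOn_spec hA hs hf) (contOn_spec hA hs hg)

lemma fc_const_mul (hA : IsSelfAdjoint A) (hs : spectrum ℝ A ⊆ Set.Icc a b) (c : ℂ) {f : ℝ → ℂ}
    (hf : ContinuousOn f (Set.Icc a b)) :
    fc (fun x => c * f x) A = c • fc f A :=
  cfc_const_mul _ _ _ (contOn_spec hA hs hf)

lemma fc_const (hA : IsSelfAdjoint A) (c : ℂ) :
    fc (fun _ => c) A = c • (1 : H →L[ℂ] H) := by
  unfold fc
  rw [cfc_const _ _ hA.isStarNormal, Algebra.algebraMap_eq_smul_one]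

lemma fc_one (hA : IsSelfAdjoint A) : fc (fun _ => 1) A = 1 := by
  rw [fc_const hA, one_smul]

lemma fc_norm_le (hA : IsSelfAdjoint A) (hs : spectrum ℝ A ⊆ Set.Icc a b) {f : ℝ → ℂ}
    {m : ℝ} (hm : 0 ≤ m) (hf : ∀ x ∈ Set.Icc a b, ‖f x‖ ≤ m) : ‖fc f A‖ ≤ m :=
  norm_cfc_le hm fun _ hz => hf _ (spec_re hA hs hz).1

lemma fc_adjoint (f : ℝ → ℂ) : adjoint (fc f A) = fc (fun x => (starRingEnd ℂ) (f x)) A :=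
  (cfc_star (fun z : ℂ => f z.re) A).symm

lemma fc_ofReal (hA : IsSelfAdjoint A) (f : ℝ → ℝ) : fc (fun x => (f x : ℂ)) A = cfc f A :=
  (cfc_real_eq_complex f hA).symm

lemma fc_nonneg (hA : IsSelfAdjoint A) (hs : spectrum ℝ A ⊆ Set.Icc a b) {f : ℝ → ℝ}
    (hf : ∀ x ∈ Set.Icc a b, 0 ≤ f x) : 0 ≤ fc (fun x => (f x : ℂ)) A := by
  rw [fc_ofReal hA]
  exact cfc_nonneg fun x hx => hf x (hs hx)

lemma fc_id (hA : IsSelfAdjoint A) : fc (fun x => (x : ℂ)) A = A := by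
  rw [fc_ofReal hA (fun x => x)]
  exact cfc_id' ℝ A

lemma fc_eval (hA : IsSelfAdjoint A) (p : ℂ[X]) :
    fc (fun x => p.eval (x : ℂ)) A = aeval A p := by
  rw [← cfc_polynomial (R := ℂ) p A hA.isStarNormal]
  refine cfc_congr fun z hz => ?_
  simp only
  rw [← hA.mem_spectrum_eq_re hz]

lemma fc_commute (f g : ℝ → ℂ) : fc f A * fc g A = fc g A * fc f A :=
  cfc_commute_cfc _ _ A

lemma fc_commute_self (hA : IsSelfAdjoint A) (f : ℝ → ℂ) : fc f A * A = A * fc f A := by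
  have := fc_commute (A := A) f (fun x => (x : ℂ))
  rwa [fc_id hA] at this

lemma fc_dist_le (hA : IsSelfAdjoint A) (hs : spectrum ℝ A ⊆ Set.Icc a b) {f g : ℝ → ℂ}
    (hf : ContinuousOn f (Set.Icc a b)) (hg : ContinuousOn g (Set.Icc a b))
    {m : ℝ} (hm : 0 ≤ m) (h : ∀ x ∈ Set.Icc a b, ‖f x - g x‖ ≤ m) : ‖fc f A - fc g A‖ ≤ m := by
  rw [← fc_sub hA hs hf hg]
  exact fc_norm_le hA hs hm h
end fcsec

/-! ### Countability of the basis, integrals of trace class operators -/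
section intsec
variable {ι : Type*} {e : HilbertBasis ι ℂ H}

lemma countable_basis (e : HilbertBasis ι ℂ H) : Countable ι := by
  have h : Pairwise (Function.onFun Disjoint fun i => Metric.ball (e i) (1/2 : ℝ)) := by
    intro i j hij
    refine Metric.ball_disjoint_ball ?_
    have h1 : ‖e i - e j‖ ^ 2 = 2 := by
      rw [@norm_sub_sq ℂ, e.orthonormal.1 i, e.orthonormal.1 j, e.orthonormal.2 hij]
      norm_num
    rw [dist_eq_norm]
    nlinarith [norm_nonneg (e i - e j)]
  exact h.countable_of_isOpen_disjoint (fun i => Metric.isOpen_ball)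
    (fun i => Metric.nonempty_ball.2 (by norm_num))

lemma inner_integral {Ω : Type*} [MeasurableSpace Ω] {μ : Measure Ω} {F : Ω → (H →L[ℂ] H)}
    (hF : Integrable F μ) (W : H →L[ℂ] H) (x : H) :
    Integrable (fun ω => ⟪x, W (F ω x)⟫_ℂ) μ ∧
    ⟪x, W ((∫ ω, F ω ∂μ) x)⟫_ℂ = ∫ ω, ⟪x, W (F ω x)⟫_ℂ ∂μ := by
  let L : (H →L[ℂ] H) →L[ℂ] ℂ :=
    (innerSL ℂ x).comp (W.comp (ContinuousLinearMap.apply ℂ H x))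
  exact ⟨L.integrable_comp hF, (L.integral_comp_comm hF).symm⟩

lemma nuc_integral_le {Ω : Type*} [MeasurableSpace Ω] {μ : Measure Ω} {F : Ω → (H →L[ℂ] H)}
    (hF : Integrable F μ) : nuc e (∫ ω, F ω ∂μ) ≤ ∫⁻ ω, nuc e (F ω) ∂μ := by
  have := countable_basis e
  refine iSup₂_le fun W hW => ?_
  calc ∑' i, ‖⟪e i, W ((∫ ω, F ω ∂μ) (e i))⟫_ℂ‖ₑ
      ≤ ∑' i, ∫⁻ ω, ‖⟪e i, W (F ω (e i))⟫_ℂ‖ₑ ∂μ := by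
        refine ENNReal.tsum_le_tsum fun i => ?_
        rw [(inner_integral hF W (e i)).2]
        exact enorm_integral_le_lintegral_enorm _
    _ = ∫⁻ ω, ∑' i, ‖⟪e i, W (F ω (e i))⟫_ℂ‖ₑ ∂μ := by
        rw [lintegral_tsum]
        exact fun i => (inner_integral hF W (e i)).1.aestronglyMeasurable.enorm
    _ ≤ ∫⁻ ω, nuc e (F ω) ∂μ := by
        refine lintegral_mono fun ω => ?_
        exact le_iSup₂_of_le W hW le_rfl

lemma trace_integral {Ω : Type*} [MeasurableSpace Ω] {μ : Measure Ω} {F : Ω → (H →L[ℂ] H)}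
    (hF : Integrable F μ) (h : ∫⁻ ω, nuc e (F ω) ∂μ ≠ ∞) :
    trace e (∫ ω, F ω ∂μ) = ∫ ω, trace e (F ω) ∂μ := by
  have := countable_basis e
  unfold trace
  rw [integral_tsum]
  · refine tsum_congr fun i => ?_
    simpa using (inner_integral hF 1 (e i)).2
  · intro i
    simpa using (inner_integral hF 1 (e i)).1.aestronglyMeasurable
  · have h1 : ∀ i, AEMeasurable (fun ω => ‖⟪e i, F ω (e i)⟫_ℂ‖ₑ) μ := fun i => by
      simpa using (inner_integral hF 1 (e i)).1.aestronglyMeasurable.enorm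
    rw [← lintegral_tsum h1]
    exact ne_top_of_le_ne_top h (lintegral_mono fun ω => tsum_enorm_le_nuc e (F ω))
end intsec

/-! ### The one-variable commutator formula -/
section onevar
variable {ι : Type*} {e : HilbertBasis ι ℂ H} {A B : H →L[ℂ] H} {a b : ℝ}

lemma comm_pow (hK : TC e (B * A - A * B)) (n : ℕ) :
    TC e (B * A ^ n - A ^ n * B) ∧ ∀ Z : H →L[ℂ] H, Commute Z A →
      trace e (Z * (B * A ^ n - A ^ n * B)) = n * trace e (Z * A ^ (n - 1) * (B * A - A * B)) := by
  induction n with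
  | zero =>
    have : B * A ^ 0 - A ^ 0 * B = 0 := by simp
    rw [this]
    refine ⟨TC.zero, fun Z _ => ?_⟩
    simp [trace]
  | succ n ih =>
    have h : B * A ^ (n + 1) - A ^ (n + 1) * B =
        (B * A ^ n - A ^ n * B) * A + A ^ n * (B * A - A * B) := by
      rw [pow_succ]; noncomm_ring
    have h1 : TC e ((B * A ^ n - A ^ n * B) * A) := ih.1.mul_right A
    have h2 : TC e (A ^ n * (B * A - A * B)) := hK.mul_left _
    rw [h]
    refine ⟨h1.add h2, fun Z hZ => ?_⟩
    rw [mul_add, trace_add (h1.mul_left Z) (h2.mul_left Z), ← mul_assoc,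
      trace_mul_comm (ih.1.mul_left Z) A, ← mul_assoc, ih.2 (A * Z) ((Commute.refl A).mul_left hZ)]
    rcases n with _ | n
    · simp
    · have : A * Z * A ^ (n + 1 - 1) = Z * A ^ (n + 1) := by
        rw [← hZ.eq, mul_assoc, Nat.add_sub_cancel, pow_succ']
      rw [this, Nat.add_sub_cancel, ← mul_assoc]
      push_cast
      ring

lemma comm_aeval (hK : TC e (B * A - A * B)) (p : ℂ[X]) :
    TC e (B * aeval A p - aeval A p * B) ∧
      trace e (B * aeval A p - aeval A p * B) =
        trace e (aeval A (derivative p) * (B * A - A * B)) := by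
  induction p using Polynomial.induction_on' with
  | add p q hp hq =>
    have : B * aeval A (p + q) - aeval A (p + q) * B =
      (B * aeval A p - aeval A p * B) + (B * aeval A q - aeval A q * B) := by
      rw [map_add]; noncomm_ring
    rw [this]
    refine ⟨hp.1.add hq.1, ?_⟩
    rw [trace_add hp.1 hq.1, hp.2, hq.2, derivative_add, map_add, add_mul,
      trace_add (hK.mul_left _) (hK.mul_left _)]
  | monomial n c =>
    have h := comm_pow hK n
    have : B * aeval A (monomial n c) - aeval A (monomial n c) * B =
      c • (B * A ^ n - A ^ n * B) := by
      rw [aeval_monomial, Algebra.algebraMap_eq_smul_one, smul_sub]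
      simp
    rw [this]
    refine ⟨h.1.smul c, ?_⟩
    have h2 := h.2 1 (Commute.one_left A)
    rw [one_mul, one_mul] at h2
    rw [trace_smul, h2, derivative_monomial, aeval_monomial, Algebra.algebraMap_eq_smul_one,
      smul_mul_assoc, one_mul, smul_mul_assoc, trace_smul]
    ring

/-- The unitary group generated by `A`. -/
noncomputable def Vop (A : H →L[ℂ] H) (α : ℝ) : H →L[ℂ] H :=
  fc (fun x => Complex.exp (Complex.I * α * x)) A

lemma Vop_eq (hA : IsSelfAdjoint A) (α : ℝ) :
    Vop A α = NormedSpace.exp (α • (Complex.I • A)) := by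
  have hn : IsStarNormal A := hA.isStarNormal
  have h1 : α • (Complex.I • A) = (Complex.I * α) • A := by
    rw [mul_comm, mul_smul, Complex.coe_smul]
  have hn2 : IsStarNormal ((Complex.I * (α : ℂ)) • A) := by
    constructor
    rw [star_smul]
    exact (hn.star_comm_self.smul_left _).smul_right _
  rw [h1, ← CFC.complex_exp_eq_normedSpace_exp hn2, ← cfc_comp_const_mul (Complex.I * (α : ℂ)) Complex.exp A (by fun_prop) hn]
  unfold Vop fc
  refine cfc_congr fun z hz => ?_
  simp only
  rw [← hA.mem_spectrum_eq_re hz]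

lemma Vop_deriv (hA : IsSelfAdjoint A) (α : ℝ) :
    HasDerivAt (Vop A) (Vop A α * (Complex.I • A)) α := by
  have h : Vop A = fun u : ℝ => NormedSpace.exp (u • (Complex.I • A)) := funext (Vop_eq hA)
  rw [h]
  exact hasDerivAt_exp_smul_const (Complex.I • A) α

lemma Vop_deriv' (hA : IsSelfAdjoint A) (α : ℝ) :
    HasDerivAt (Vop A) ((Complex.I • A) * Vop A α) α := by
  have h : Vop A = fun u : ℝ => NormedSpace.exp (u • (Complex.I • A)) := funext (Vop_eq hA)
  rw [h]
  exact hasDerivAt_exp_smul_const' (Complex.I • A) α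

lemma Vop_cont (hA : IsSelfAdjoint A) : Continuous (Vop A) :=
  continuous_iff_continuousAt.2 fun α => (Vop_deriv hA α).continuousAt

lemma norm_exp_I (α x : ℝ) : ‖Complex.exp (Complex.I * α * x)‖ = 1 := by
  have : Complex.I * α * x = ((α * x : ℝ) : ℂ) * Complex.I := by push_cast; ring
  rw [this, Complex.norm_exp_ofReal_mul_I]

lemma Vop_norm (hA : IsSelfAdjoint A) (hs : spectrum ℝ A ⊆ Set.Icc a b) (α : ℝ) :
    ‖Vop A α‖ ≤ 1 :=
  fc_norm_le hA hs zero_le_one fun x _ => (norm_exp_I α x).le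

lemma Vop_add (hA : IsSelfAdjoint A) (hs : spectrum ℝ A ⊆ Set.Icc a b) (α β : ℝ) :
    Vop A α * Vop A β = Vop A (α + β) := by
  unfold Vop
  rw [← fc_mul hA hs (by fun_prop) (by fun_prop)]
  refine fc_congr hA hs fun x _ => ?_
  rw [← Complex.exp_add]
  push_cast
  ring_nf

lemma Vop_zero (hA : IsSelfAdjoint A) : Vop A 0 = 1 := by
  unfold Vop
  simp [fc_one hA]

lemma Vop_comm (hA : IsSelfAdjoint A) (α : ℝ) (B : H →L[ℂ] H) :
    Continuous (fun s : ℝ =>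
      Vop A ((1 - s) * α) * ((Complex.I * α) • (B * A - A * B)) * Vop A (s * α)) ∧
    B * Vop A α - Vop A α * B =
      ∫ s in (0:ℝ)..1, Vop A ((1 - s) * α) * ((Complex.I * α) • (B * A - A * B)) * Vop A (s * α) := by
  have hc : Continuous (fun s : ℝ =>
      Vop A ((1 - s) * α) * ((Complex.I * α) • (B * A - A * B)) * Vop A (s * α)) := by
    have := Vop_cont hA
    fun_prop
  refine ⟨hc, ?_⟩
  have hd : ∀ s : ℝ, HasDerivAt (fun s : ℝ => Vop A ((1 - s) * α) * B * Vop A (s * α))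
      (Vop A ((1 - s) * α) * ((Complex.I * α) • (B * A - A * B)) * Vop A (s * α)) s := by
    intro s
    have h1 : HasDerivAt (fun s : ℝ => Vop A ((1 - s) * α))
        ((-α) • (Vop A ((1 - s) * α) * (Complex.I • A))) s := by
      refine HasDerivAt.scomp (h := fun s : ℝ => (1 - s) * α) s (Vop_deriv hA ((1 - s) * α)) ?_
      simpa using ((hasDerivAt_id s).const_sub 1).mul_const α
    have h2 : HasDerivAt (fun s : ℝ => Vop A (s * α))
        (α • ((Complex.I • A) * Vop A (s * α))) s := by
      refine HasDerivAt.scomp (h := fun s : ℝ => s * α) s (Vop_deriv' hA (s * α)) ?_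
      simpa using ((hasDerivAt_id s)).mul_const α
    convert! (h1.mul_const B).mul h2 using 1
    have e1 : ∀ Z : H →L[ℂ] H, (-α) • Z = (-(α:ℂ)) • Z := fun Z => by
      rw [← Complex.ofReal_neg, Complex.coe_smul]
    have e2 : ∀ Z : H →L[ℂ] H, α • Z = (α:ℂ) • Z := fun Z => (Complex.coe_smul α Z).symm
    rw [e1, e2]
    simp only [mul_smul_comm, smul_mul_assoc, mul_sub, sub_mul, smul_sub, smul_smul, mul_assoc]
    rw [sub_eq_add_neg, add_comm, ← neg_smul]
    congr 2 <;> ring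
  rw [intervalIntegral.integral_eq_sub_of_hasDerivAt (fun s _ => hd s) (hc.intervalIntegrable _ _)]
  simp [Vop_zero hA]

lemma enorm_le_one {Z : H →L[ℂ] H} (h : ‖Z‖ ≤ 1) : ‖Z‖ₑ ≤ 1 := by
  rw [← ofReal_norm]
  exact ENNReal.ofReal_le_one.2 h

lemma Vop_comm_nuc (hA : IsSelfAdjoint A) (hs : spectrum ℝ A ⊆ Set.Icc a b)
    (hK : TC e (B * A - A * B)) (α : ℝ) :
    nuc e (B * Vop A α - Vop A α * B) ≤ ‖α‖ₑ * nuc e (B * A - A * B) ∧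
    trace e (B * Vop A α - Vop A α * B) = Complex.I * α * trace e (Vop A α * (B * A - A * B)) := by
  obtain ⟨hc, h⟩ := Vop_comm hA α B
  set K := B * A - A * B with hKdef
  rw [h, intervalIntegral.integral_of_le zero_le_one]
  have hInt : IntegrableOn (fun s : ℝ =>
      Vop A ((1 - s) * α) * ((Complex.I * α) • K) * Vop A (s * α)) (Set.Ioc 0 1) :=
    (hc.continuousOn.integrableOn_Icc).mono_set Set.Ioc_subset_Icc_self
  have hb : ∀ s : ℝ, nuc e (Vop A ((1 - s) * α) * ((Complex.I * α) • K) * Vop A (s * α)) ≤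
      ‖α‖ₑ * nuc e K := by
    intro s
    refine (nuc_mul_right e _ _).trans ?_
    refine (mul_le_of_le_one_right (by simp) (enorm_le_one (Vop_norm hA hs _))).trans ?_
    refine (nuc_mul_left e _ _).trans ?_
    refine (mul_le_of_le_one_left (by simp) (enorm_le_one (Vop_norm hA hs _))).trans ?_
    refine (nuc_smul e _ _).trans (le_of_eq ?_)
    congr 1
    rw [← ofReal_norm, ← ofReal_norm]
    simp
  have hle : ∫⁻ s in Set.Ioc (0:ℝ) 1,
      nuc e (Vop A ((1 - s) * α) * ((Complex.I * α) • K) * Vop A (s * α)) ≤ ‖α‖ₑ * nuc e K := by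
    refine (lintegral_mono hb).trans ?_
    simp
  refine ⟨(nuc_integral_le hInt).trans hle, ?_⟩
  rw [trace_integral hInt (ne_top_of_le_ne_top (ENNReal.mul_ne_top enorm_ne_top hK) hle)]
  have ht : ∀ s : ℝ, trace e (Vop A ((1 - s) * α) * ((Complex.I * α) • K) * Vop A (s * α)) =
      Complex.I * α * trace e (Vop A α * K) := by
    intro s
    rw [trace_mul_comm ((hK.smul _).mul_left _), ← mul_assoc, Vop_add hA hs, mul_smul_comm,
      trace_smul]
    congr 4
    ring
  simp_rw [ht]
  simp

/-- Fourier-type integral. -/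
noncomputable def Fou (h : ℝ → ℂ) (β : ℝ) : ℂ :=
  ∫ α : ℝ, Complex.exp (Complex.I * (α : ℂ) * (β : ℂ)) • h α

lemma Fou_integrable {h : ℝ → ℂ} (hh : Integrable h) (β : ℝ) :
    Integrable (fun α : ℝ => Complex.exp (Complex.I * (α : ℂ) * (β : ℂ)) • h α) := by
  have hc : Continuous (fun α : ℝ => Complex.exp (Complex.I * (α : ℂ) * (β : ℂ))) := by fun_prop
  refine hh.bdd_smul 1 hc.aestronglyMeasurable ?_
  exact Filter.Eventually.of_forall fun α => (norm_exp_I α β).le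

lemma Fou_cont {h : ℝ → ℂ} (hh : Integrable h) : Continuous (Fou h) := by
  unfold Fou
  refine continuous_of_dominated (bound := fun α => ‖h α‖)
    (fun β => (Fou_integrable hh β).aestronglyMeasurable) (fun β => ?_) hh.norm ?_
  · refine Filter.Eventually.of_forall fun α => ?_
    rw [norm_smul, norm_exp_I, one_mul]
  · exact Filter.Eventually.of_forall fun α => by fun_prop

lemma Fou_deriv {h : ℝ → ℂ} (hh : Integrable h) (hh' : Integrable (fun α : ℝ => α • h α)) (β : ℝ) :
    HasDerivAt (Fou h) (Fou (fun α => Complex.I * (α • h α)) β) β := by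
  unfold Fou
  refine (hasDerivAt_integral_of_dominated_loc_of_deriv_le (bound := fun α => ‖α • h α‖)
    (F' := fun β α => Complex.exp (Complex.I * (α : ℂ) * (β : ℂ)) • (Complex.I * (α • h α)))
    Filter.univ_mem
    (Filter.Eventually.of_forall fun β => (Fou_integrable hh β).aestronglyMeasurable)
    (Fou_integrable hh β) (Fou_integrable (hh'.const_mul _) β).aestronglyMeasurable ?_
    hh'.norm ?_).2
  · refine Filter.Eventually.of_forall fun α x _ => ?_
    rw [norm_smul, norm_exp_I, one_mul, norm_mul, Complex.norm_I, one_mul]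
  · refine Filter.Eventually.of_forall fun α x _ => ?_
    have h1 : HasDerivAt (fun x : ℝ => Complex.I * (α : ℂ) * (x : ℂ)) (Complex.I * (α : ℂ)) x := by
      simpa using (Complex.ofRealCLM.hasDerivAt (x := x)).const_mul (Complex.I * (α : ℂ))
    convert! (h1.cexp).smul_const (h α) using 1
    simp only [smul_eq_mul, Complex.real_smul]
    ring

lemma Vop_smul_integrable (hA : IsSelfAdjoint A) (hs : spectrum ℝ A ⊆ Set.Icc a b)
    {h : ℝ → ℂ} (hh : Integrable h) : Integrable (fun α : ℝ => h α • Vop A α) := by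
  refine hh.smul_bdd 1 (Vop_cont hA).aestronglyMeasurable ?_
  exact Filter.Eventually.of_forall fun α => Vop_norm hA hs α

lemma fc_Fou (hA : IsSelfAdjoint A) {h : ℝ → ℂ} (hh : Integrable h) :
    fc (Fou h) A = ∫ α : ℝ, h α • Vop A α := by
  have hn : IsStarNormal A := hA.isStarNormal
  have hcs : CompactSpace (spectrum ℂ A) := isCompact_iff_compactSpace.1 (spectrum.isCompact A)
  unfold fc Fou
  have hmk : ∀ α : ℝ, ContinuousMap.mkD ((spectrum ℂ A).domRestrict
      (fun z : ℂ => Complex.exp (Complex.I * (α : ℂ) * (z.re : ℂ)) • h α)) 0 =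
      h α • ContinuousMap.mkD ((spectrum ℂ A).domRestrict
      (fun z : ℂ => Complex.exp (Complex.I * (α : ℂ) * (z.re : ℂ)))) 0 := by
    intro α
    ext z
    rw [ContinuousMap.smul_apply, ContinuousMap.mkD_apply_of_continuousOn (by fun_prop),
      ContinuousMap.mkD_apply_of_continuousOn (by fun_prop)]
    simp [mul_comm]
  rw [cfc_integral' (fun (α : ℝ) (z : ℂ) => Complex.exp (Complex.I * (α : ℂ) * (z.re : ℂ)) • h α) A
    (Filter.Eventually.of_forall fun α => by fun_prop) ?_ hn]
  · refine integral_congr_ae (Filter.Eventually.of_forall fun α => ?_)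
    simp only [smul_eq_mul]
    unfold Vop fc
    rw [← cfc_smul _ _ _ (by fun_prop)]
    simp [mul_comm]
  · simp_rw [hmk]
    refine hh.smul_bdd 1 ?_ ?_
    · exact ContinuousMap.aeStronglyMeasurable_mkD_restrict_of_uncurry
        (fun (α : ℝ) (z : ℂ) => Complex.exp (Complex.I * (α : ℂ) * (z.re : ℂ))) _
        (Continuous.continuousOn (by fun_prop))
    · refine Filter.Eventually.of_forall fun α => ?_
      refine (ContinuousMap.norm_le _ zero_le_one).2 fun z => ?_
      rw [ContinuousMap.mkD_apply_of_continuousOn (by fun_prop)]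
      simp [norm_exp_I]

lemma comm_Fou (hA : IsSelfAdjoint A) (hs : spectrum ℝ A ⊆ Set.Icc a b)
    (hK : TC e (B * A - A * B)) {h : ℝ → ℂ} (hh : Integrable h)
    (hh' : Integrable (fun α : ℝ => α • h α)) :
    TC e (B * fc (Fou h) A - fc (Fou h) A * B) ∧
    trace e (B * fc (Fou h) A - fc (Fou h) A * B) =
      trace e (fc (Fou (fun α => Complex.I * (α • h α))) A * (B * A - A * B)) := by
  have hi := Vop_smul_integrable hA hs hh
  have hi' := Vop_smul_integrable hA hs (hh'.const_mul Complex.I)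
  have hL : Integrable (fun α : ℝ => B * (h α • Vop A α)) := hi.const_mul B
  have hR : Integrable (fun α : ℝ => (h α • Vop A α) * B) := hi.mul_const B
  have e1 : B * fc (Fou h) A - fc (Fou h) A * B =
      ∫ α : ℝ, (B * (h α • Vop A α) - (h α • Vop A α) * B) := by
    rw [integral_sub hL hR, fc_Fou hA hh]
    congr 1
    · exact ((ContinuousLinearMap.mul ℂ (H →L[ℂ] H) B).integral_comp_comm hi).symm
    · exact (((ContinuousLinearMap.mul ℂ (H →L[ℂ] H)).flip B).integral_comp_comm hi).symm
  have e2 : fc (Fou (fun α => Complex.I * (α • h α))) A * (B * A - A * B) =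
      ∫ α : ℝ, ((Complex.I * (α • h α)) • Vop A α) * (B * A - A * B) := by
    rw [fc_Fou hA (hh'.const_mul _)]
    exact (((ContinuousLinearMap.mul ℂ (H →L[ℂ] H)).flip (B * A - A * B)).integral_comp_comm hi').symm
  have e3 : ∀ α : ℝ, (B * (h α • Vop A α) - (h α • Vop A α) * B) =
      h α • (B * Vop A α - Vop A α * B) := fun α => by
    rw [mul_smul_comm, smul_mul_assoc, smul_sub]
  have hfin : ∫⁻ α : ℝ, ‖α • h α‖ₑ * nuc e (B * A - A * B) ≠ ∞ := by
    rw [lintegral_mul_const'' _ hh'.aestronglyMeasurable.enorm]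
    exact ENNReal.mul_ne_top hh'.2.ne hK
  have hb1 : ∫⁻ α : ℝ, nuc e (B * (h α • Vop A α) - (h α • Vop A α) * B) ≠ ∞ := by
    refine ne_top_of_le_ne_top hfin (lintegral_mono fun α => ?_)
    rw [e3]
    refine (nuc_smul e _ _).trans ?_
    refine (mul_le_mul_right (Vop_comm_nuc hA hs hK α).1 _).trans (le_of_eq ?_)
    rw [enorm_smul]; ring
  have hb2 : ∫⁻ α : ℝ, nuc e (((Complex.I * (α • h α)) • Vop A α) * (B * A - A * B)) ≠ ∞ := by
    refine ne_top_of_le_ne_top hfin (lintegral_mono fun α => ?_)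
    refine (nuc_mul_left e _ _).trans ?_
    refine mul_le_mul_left ?_ _
    rw [enorm_smul, enorm_mul]
    refine (mul_le_of_le_one_right (by simp) (enorm_le_one (Vop_norm hA hs _))).trans (le_of_eq ?_)
    rw [← ofReal_norm Complex.I]
    simp
  rw [e1, e2]
  refine ⟨ne_top_of_le_ne_top hb1 (nuc_integral_le (hL.sub hR)), ?_⟩
  have t1 := trace_integral (e := e)
    (F := fun α : ℝ => B * (h α • Vop A α) - (h α • Vop A α) * B) (hL.sub hR) hb1
  rw [t1, trace_integral (hi'.mul_const _) hb2]
  refine integral_congr_ae (Filter.Eventually.of_forall fun α => ?_)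
  simp only
  rw [e3, trace_smul, (Vop_comm_nuc hA hs hK α).2, smul_mul_assoc, trace_smul, Complex.real_smul]
  ring

/-- For a polynomial or `C¹₁` function: it is `C¹`. -/
lemma P_contDiff {P : (ℝ → ℂ) → Prop} (hP : P = MemC11 ∨ P = IsPolyFun) {φ : ℝ → ℂ} (hφ : P φ) :
    Differentiable ℝ φ ∧ Continuous (deriv φ) := by
  rcases hP with rfl | rfl
  · obtain ⟨g, h1, h2, h3⟩ := hφ
    have hd : ∀ β, HasDerivAt φ ((Real.sqrt (2 * Real.pi))⁻¹ •
        Fou (fun α => Complex.I * (α • g α)) β) β := by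
      intro β
      have : φ = fun β => (Real.sqrt (2 * Real.pi))⁻¹ • Fou g β := funext h3
      rw [this]
      exact (Fou_deriv h1 h2 β).fun_const_smul (Real.sqrt (2 * Real.pi))⁻¹
    refine ⟨fun β => (hd β).differentiableAt, ?_⟩
    have : deriv φ = fun β => (Real.sqrt (2 * Real.pi))⁻¹ •
        Fou (fun α => Complex.I * (α • g α)) β := funext fun β => (hd β).deriv
    rw [this]
    exact (Fou_cont (h2.const_mul Complex.I)).fun_const_smul (Real.sqrt (2 * Real.pi))⁻¹
  · obtain ⟨p, hp⟩ := hφ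
    have hd : ∀ β : ℝ, HasDerivAt φ ((derivative p).eval (β : ℂ)) β := by
      intro β
      have : φ = fun β : ℝ => p.eval (β : ℂ) := funext hp
      rw [this]
      exact (p.hasDerivAt (β : ℂ)).comp_ofReal
    refine ⟨fun β => (hd β).differentiableAt, ?_⟩
    have : deriv φ = fun β : ℝ => (derivative p).eval (β : ℂ) := funext fun β => (hd β).deriv
    rw [this]
    exact (derivative p).continuous.comp Complex.continuous_ofReal

lemma deriv_eval (p : ℂ[X]) : deriv (fun t : ℝ => p.eval (t : ℂ)) =
    fun β : ℝ => (derivative p).eval (β : ℂ) :=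
  funext fun β => (p.hasDerivAt (β : ℂ)).comp_ofReal.deriv

lemma onevar {P : (ℝ → ℂ) → Prop} (hP : P = MemC11 ∨ P = IsPolyFun) {φ : ℝ → ℂ} (hφ : P φ)
    (hA : IsSelfAdjoint A) (hs : spectrum ℝ A ⊆ Set.Icc a b) (hK : TC e (B * A - A * B)) :
    TC e (B * fc φ A - fc φ A * B) ∧
    trace e (B * fc φ A - fc φ A * B) = trace e (fc (deriv φ) A * (B * A - A * B)) := by
  rcases hP with rfl | rfl
  · obtain ⟨g, h1, h2, h3⟩ := hφ
    set c : ℂ := (((Real.sqrt (2 * Real.pi))⁻¹ : ℝ) : ℂ) with hc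
    have hφ' : φ = fun β => c * Fou g β := by
      funext β
      rw [h3 β, hc, ← Complex.real_smul]; rfl
    have hd : deriv φ = fun β => c * Fou (fun α => Complex.I * (α • g α)) β := by
      funext β
      rw [hφ']
      exact ((Fou_deriv h1 h2 β).const_mul c).deriv
    have f1 : fc φ A = c • fc (Fou g) A := by
      rw [hφ']; exact fc_const_mul hA hs c (Fou_cont h1).continuousOn
    have f2 : fc (deriv φ) A = c • fc (Fou (fun α => Complex.I * (α • g α))) A := by
      rw [hd]; exact fc_const_mul hA hs c (Fou_cont (h2.const_mul _)).continuousOn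
    have e3 : B * fc φ A - fc φ A * B = c • (B * fc (Fou g) A - fc (Fou g) A * B) := by
      rw [f1, mul_smul_comm, smul_mul_assoc, smul_sub]
    obtain ⟨g1, g2⟩ := comm_Fou hA hs hK h1 h2
    rw [e3, f2]
    refine ⟨g1.smul c, ?_⟩
    rw [trace_smul, g2, smul_mul_assoc, trace_smul]
  · obtain ⟨p, hp⟩ := hφ
    have : φ = fun β : ℝ => p.eval (β : ℂ) := funext hp
    rw [this, deriv_eval, fc_eval hA, fc_eval hA]
    exact comm_aeval hK p
end onevar

/-! ### Cayley transform -/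
section cayley
variable {ι : Type*} {e : HilbertBasis ι ℂ H} {A B : H →L[ℂ] H} {a b : ℝ}

lemma cay_ne (t : ℝ) {ε : ℝ} (hε : 0 < ε) (x : ℝ) : ((x : ℂ) - t + Complex.I * ε) ≠ 0 := by
  intro h
  have := congrArg Complex.im h
  simp at this
  exact hε.ne' this

lemma cay_ne' (t : ℝ) {ε : ℝ} (hε : 0 < ε) (x : ℝ) : ((x : ℂ) - t - Complex.I * ε) ≠ 0 := by
  intro h
  have := congrArg Complex.im h
  simp at this
  exact hε.ne' this

/-- The Poisson kernel (without the factor `1/π`). -/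
noncomputable def pk (ε t x : ℝ) : ℝ := ε / ((x - t) ^ 2 + ε ^ 2)

lemma pk_den {ε : ℝ} (hε : 0 < ε) (t x : ℝ) : 0 < (x - t) ^ 2 + ε ^ 2 := by positivity

lemma pk_cont {ε : ℝ} (hε : 0 < ε) (t : ℝ) : Continuous (pk ε t) := by
  unfold pk
  exact Continuous.div (by fun_prop) (by fun_prop) fun x => (pk_den hε t x).ne'

lemma exists_cayley (hA : IsSelfAdjoint A) (hs : spectrum ℝ A ⊆ Set.Icc a b) {ε : ℝ} (hε : 0 < ε)
    (t : ℝ) : ∃ U R : H →L[ℂ] H, U * adjoint U = 1 ∧ adjoint U * U = 1 ∧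
      (ε : ℂ) • (adjoint R * R) = fc (fun x => (pk ε t x : ℂ)) A ∧
      ∀ B : H →L[ℂ] H, U * B * adjoint U - B =
        (-(2 * Complex.I * ε)) • (R * (B * A - A * B) * adjoint R) := by
  set r : ℝ → ℂ := fun x => ((x : ℂ) - t + Complex.I * ε)⁻¹ with hr
  have hrc : Continuous r := Continuous.inv₀ (by fun_prop) (cay_ne t hε)
  set u : ℝ → ℂ := fun x => 1 - 2 * Complex.I * ε * r x with hu
  have huc : Continuous u := by fun_prop
  have hconjr : ∀ x, (starRingEnd ℂ) (r x) = ((x : ℂ) - t - Complex.I * ε)⁻¹ := by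
    intro x
    simp only [hr, map_inv₀, map_add, map_sub, map_mul, Complex.conj_ofReal, Complex.conj_I]
    ring_nf
  have hu1 : ∀ x, u x = ((x : ℂ) - t - Complex.I * ε) * r x := by
    intro x
    simp only [hu, hr]
    have := cay_ne t hε x
    field_simp
    ring
  have hconju : ∀ x, (starRingEnd ℂ) (u x) = ((x : ℂ) - t + Complex.I * ε) *
      ((x : ℂ) - t - Complex.I * ε)⁻¹ := by
    intro x
    rw [hu1, map_mul, hconjr]
    congr 1
    simp only [map_sub, map_mul, Complex.conj_ofReal, Complex.conj_I]
    ring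
  have huu : ∀ x, u x * (starRingEnd ℂ) (u x) = 1 := by
    intro x
    rw [hconju, hu1]
    simp only [hr]
    have := cay_ne t hε x
    have := cay_ne' t hε x
    field_simp
  have hucc : Continuous (fun x => (starRingEnd ℂ) (u x)) := Complex.continuous_conj.comp huc
  have hrcc : Continuous (fun x => (starRingEnd ℂ) (r x)) := Complex.continuous_conj.comp hrc
  refine ⟨fc u A, fc r A, ?_, ?_, ?_, ?_⟩
  · rw [fc_adjoint, ← fc_mul hA hs huc.continuousOn hucc.continuousOn, ← fc_one hA]
    exact fc_congr hA hs fun x _ => huu x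
  · rw [fc_adjoint, ← fc_mul hA hs hucc.continuousOn huc.continuousOn, ← fc_one hA]
    exact fc_congr hA hs fun x _ => (mul_comm _ _).trans (huu x)
  · rw [fc_adjoint, ← fc_mul hA hs hrcc.continuousOn hrc.continuousOn,
      ← fc_const_mul hA hs _ (f := fun x => (starRingEnd ℂ) (r x) * r x)
        (hrcc.mul hrc).continuousOn]
    refine fc_congr hA hs fun x _ => ?_
    rw [hconjr]
    simp only [hr, pk]
    have h1 := cay_ne t hε x
    have h2 := cay_ne' t hε x
    push_cast
    rw [div_eq_mul_inv, ← mul_inv]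
    congr 2
    ring_nf
    rw [Complex.I_sq]
    ring
  · intro B
    have hA' : fc (fun x : ℝ => (x : ℂ) - t + Complex.I * ε) A =
        A + (-t + Complex.I * ε : ℂ) • (1 : H →L[ℂ] H) := by
      have h1 := fc_add hA hs (f := fun x : ℝ => (x : ℂ)) (g := fun _ => (-t + Complex.I * ε : ℂ))
        (by fun_prop) (by fun_prop)
      rw [fc_id hA, fc_const hA] at h1
      rw [← h1]
      refine fc_congr hA hs fun x _ => ?_
      ring
    have hR1 : fc r A * (A + (-t + Complex.I * ε : ℂ) • (1 : H →L[ℂ] H)) = 1 := by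
      rw [← hA', ← fc_mul hA hs hrc.continuousOn (by fun_prop), ← fc_one hA]
      exact fc_congr hA hs fun x _ => inv_mul_cancel₀ (cay_ne t hε x)
    have hR2 : (A + (-t + Complex.I * ε : ℂ) • (1 : H →L[ℂ] H)) * fc r A = 1 := by
      rw [← hA', ← fc_mul hA hs (by fun_prop) hrc.continuousOn, ← fc_one hA]
      exact fc_congr hA hs fun x _ => mul_inv_cancel₀ (cay_ne t hε x)
    have hU : fc u A = 1 - (2 * Complex.I * ε) • fc r A := by
      rw [← fc_one hA, ← fc_const_mul hA hs _ hrc.continuousOn,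
        ← fc_sub hA hs (by fun_prop) (by fun_prop)]
    have hRU : fc r A * adjoint (fc u A) = adjoint (fc r A) := by
      rw [fc_adjoint, fc_adjoint, ← fc_mul hA hs hrc.continuousOn hucc.continuousOn]
      refine fc_congr hA hs fun x _ => ?_
      rw [hconju, hconjr]
      simp only [hr]
      rw [← mul_assoc, inv_mul_cancel₀ (cay_ne t hε x), one_mul]
    have hUU : fc u A * adjoint (fc u A) = 1 := by
      rw [fc_adjoint, ← fc_mul hA hs huc.continuousOn hucc.continuousOn, ← fc_one hA]
      exact fc_congr hA hs fun x _ => huu x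
    set A' := A + (-t + Complex.I * ε : ℂ) • (1 : H →L[ℂ] H) with hA'def
    have hk : B * A - A * B = B * A' - A' * B := by
      rw [hA'def, mul_add, add_mul, mul_smul_comm, smul_mul_assoc, mul_one, one_mul]
      abel
    have hcomm : fc u A * B - B * fc u A =
        (-(2 * Complex.I * ε)) • (fc r A * (B * A - A * B) * fc r A) := by
      rw [hk, mul_sub, sub_mul, ← mul_assoc (fc r A) A', hR1, one_mul, ← mul_assoc (fc r A) B,
        mul_assoc (fc r A * B), hR2, mul_one, hU, sub_mul, mul_sub, one_mul, mul_one,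
        smul_mul_assoc, mul_smul_comm, neg_smul, smul_sub]
      abel
    calc fc u A * B * adjoint (fc u A) - B
        = (fc u A * B - B * fc u A) * adjoint (fc u A) := by
          rw [sub_mul, mul_assoc B, hUU, mul_one]
      _ = _ := by
          rw [hcomm, smul_mul_assoc, mul_assoc _ (fc r A), hRU]
end cayley

/-! ### Monotonicity of the trace -/
section mono
variable {ι : Type*} {e : HilbertBasis ι ℂ H} {B P : H →L[ℂ] H} {a b : ℝ}

/-- The functional `Z ↦ Tr (Z P)`. -/
noncomputable def trL (hP : TC e P) : (H →L[ℂ] H) →L[ℂ] ℂ :=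
  LinearMap.mkContinuous
    { toFun := fun Z => trace e (Z * P)
      map_add' := fun Z W => by rw [add_mul, trace_add (hP.mul_left _) (hP.mul_left _)]
      map_smul' := fun c Z => by rw [smul_mul_assoc, trace_smul]; rfl }
    (nuc e P).toReal (fun Z => by
      refine (norm_trace_le (hP.mul_left _)).trans ?_
      rw [mul_comm, ← toReal_enorm Z, ← ENNReal.toReal_mul]
      exact ENNReal.toReal_mono (ENNReal.mul_ne_top enorm_ne_top hP) (nuc_mul_left e Z P))

lemma trL_apply (hP : TC e P) (Z : H →L[ℂ] H) : trL hP Z = trace e (Z * P) := rfl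

lemma trL_le (hP : TC e P) (Z : H →L[ℂ] H) : ‖trace e (Z * P)‖ ≤ (nuc e P).toReal * ‖Z‖ := by
  refine (norm_trace_le (hP.mul_left _)).trans ?_
  rw [mul_comm, ← toReal_enorm Z, ← ENNReal.toReal_mul]
  exact ENNReal.toReal_mono (ENNReal.mul_ne_top enorm_ne_top hP) (nuc_mul_left e Z P)

lemma pert_pow (hP : TC e P) (m : ℕ) :
    (∀ h : ℝ, TC e ((B + h • P) ^ m - B ^ m)) ∧ ∀ Z : H →L[ℂ] H, Commute Z B →
      ∃ G : ℝ → (H →L[ℂ] H), Continuous G ∧ G 0 = (m : ℂ) • (Z * B ^ (m - 1)) ∧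
        ∀ h : ℝ, trace e (((B + h • P) ^ m - B ^ m) * Z) = h * trace e (G h * P) := by
  induction m with
  | zero =>
    refine ⟨fun h => by simpa using TC.zero, fun Z _ => ⟨fun _ => 0, by fun_prop, by simp, ?_⟩⟩
    intro h
    simp [trace]
  | succ m ih =>
    have hrec : ∀ h : ℝ, (B + h • P) ^ (m + 1) - B ^ (m + 1) =
        ((B + h • P) ^ m - B ^ m) * B + (h : ℂ) • ((B + h • P) ^ m * P) := by
      intro h
      rw [← mul_smul_comm, Complex.coe_smul, pow_succ, pow_succ]
      noncomm_ring
    have t1 : ∀ h : ℝ, TC e (((B + h • P) ^ m - B ^ m) * B) := fun h => (ih.1 h).mul_right B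
    have t2 : ∀ h : ℝ, TC e ((h : ℂ) • ((B + h • P) ^ m * P)) := fun h => (hP.mul_left _).smul _
    refine ⟨fun h => ?_, fun Z hZ => ?_⟩
    · rw [hrec]
      exact (t1 h).add (t2 h)
    · obtain ⟨G, hG, hG0, hGt⟩ := ih.2 (B * Z) ((Commute.refl B).mul_left hZ)
      refine ⟨fun h => G h + Z * (B + h • P) ^ m, by fun_prop, ?_, fun h => ?_⟩
      · simp only [zero_smul, add_zero, hG0, Nat.add_sub_cancel]
        rcases m with _ | m
        · simp
        · rw [Nat.add_sub_cancel, ← hZ.eq, mul_assoc, ← pow_succ']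
          push_cast
          rw [add_smul (m + 1 : ℂ), one_smul]
      · rw [hrec, add_mul, trace_add ((t1 h).mul_right Z) ((t2 h).mul_right Z), mul_assoc, hGt,
          add_mul, trace_add (hP.mul_left _) (hP.mul_left _), smul_mul_assoc, trace_smul,
          trace_mul_comm (hP.mul_left _), mul_add, mul_assoc]

lemma pert_aeval (hP : TC e P) (p : ℂ[X]) :
    (∀ h : ℝ, TC e (aeval (B + h • P) p - aeval B p)) ∧
      ∃ G : ℝ → (H →L[ℂ] H), Continuous G ∧ G 0 = aeval B (derivative p) ∧
        ∀ h : ℝ, trace e (aeval (B + h • P) p - aeval B p) = h * trace e (G h * P) := by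
  induction p using Polynomial.induction_on' with
  | add p q hp hq =>
    have hr : ∀ h : ℝ, aeval (B + h • P) (p + q) - aeval B (p + q) =
        (aeval (B + h • P) p - aeval B p) + (aeval (B + h • P) q - aeval B q) := by
      intro h; rw [map_add, map_add]; abel
    obtain ⟨hp1, G1, c1, z1, k1⟩ := hp
    obtain ⟨hq1, G2, c2, z2, k2⟩ := hq
    refine ⟨fun h => by rw [hr]; exact (hp1 h).add (hq1 h), fun h => G1 h + G2 h, by fun_prop, ?_,
      fun h => ?_⟩
    · simp [z1, z2]
    · rw [hr, trace_add (hp1 h) (hq1 h), k1, k2, add_mul,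
        trace_add (hP.mul_left _) (hP.mul_left _), mul_add]
  | monomial n c =>
    obtain ⟨h1, h2⟩ := pert_pow (B := B) hP n
    obtain ⟨G, g1, g2, g3⟩ := h2 1 (Commute.one_left B)
    have hr : ∀ h : ℝ, aeval (B + h • P) (monomial n c) - aeval B (monomial n c) =
        c • ((B + h • P) ^ n - B ^ n) := by
      intro h
      simp only [aeval_monomial, Algebra.algebraMap_eq_smul_one, smul_mul_assoc, one_mul, smul_sub]
    refine ⟨fun h => by rw [hr]; exact (h1 h).smul c, fun h => c • G h, by fun_prop, ?_, fun h => ?_⟩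
    · simp only [g2, derivative_monomial, aeval_monomial, Algebra.algebraMap_eq_smul_one,
        smul_mul_assoc, one_mul, smul_smul]
    · have := g3 h
      rw [mul_one] at this
      rw [hr, trace_smul, this, smul_mul_assoc, trace_smul]
      ring

lemma spec_iff {A : H →L[ℂ] H} (hA : IsSelfAdjoint A) : spectrum ℝ A ⊆ Set.Icc a b ↔
    algebraMap ℝ (H →L[ℂ] H) a ≤ A ∧ A ≤ algebraMap ℝ (H →L[ℂ] H) b := by
  rw [algebraMap_le_iff_le_spectrum, le_algebraMap_iff_spectrum_le]
  exact ⟨fun h => ⟨fun x hx => (h hx).1, fun x hx => (h hx).2⟩, fun h x hx => ⟨h.1 x hx, h.2 x hx⟩⟩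

lemma rsmul_nonneg {P : H →L[ℂ] H} (hP0 : 0 ≤ P) {s : ℝ} (hs : 0 ≤ s) : 0 ≤ s • P := by
  rw [← Complex.coe_smul]
  rw [ContinuousLinearMap.nonneg_iff_isPositive] at hP0 ⊢
  exact hP0.smul_of_nonneg (Complex.zero_le_real.2 hs)

lemma spec_between (hB : IsSelfAdjoint B) (hP0 : 0 ≤ P)
    (hs : spectrum ℝ B ⊆ Set.Icc a b) (hs' : spectrum ℝ (B + P) ⊆ Set.Icc a b)
    {s : ℝ} (hs01 : s ∈ Set.Icc (0:ℝ) 1) :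
    IsSelfAdjoint (B + s • P) ∧ spectrum ℝ (B + s • P) ⊆ Set.Icc a b := by
  have hPsa : IsSelfAdjoint P := hP0.isSelfAdjoint
  have k1 : 0 ≤ s • P := rsmul_nonneg hP0 hs01.1
  have k2 : 0 ≤ (1 - s) • P := rsmul_nonneg hP0 (sub_nonneg.2 hs01.2)
  have k3 : B + s • P + (1 - s) • P = B + P := by
    rw [sub_smul, one_smul]; abel
  generalize s • P = S at *
  generalize (1 - s) • P = S' at *
  have hsa : IsSelfAdjoint (B + S) := hB.add k1.isSelfAdjoint
  refine ⟨hsa, ?_⟩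
  rw [spec_iff hsa]
  have h1 := (spec_iff hB).1 hs
  have h2 := (spec_iff (hB.add hPsa)).1 hs'
  rw [← k3] at h2
  exact ⟨h1.1.trans (le_add_of_nonneg_right k1), (le_add_of_nonneg_right k2).trans h2.2⟩

lemma pert_deriv (hP : TC e P) (p : ℂ[X]) (s : ℝ) :
    HasDerivAt (fun s : ℝ => trace e (aeval (B + s • P) p - aeval B p))
      (trace e (aeval (B + s • P) (derivative p) * P)) s := by
  have hTC : ∀ s : ℝ, TC e (aeval (B + s • P) p - aeval B p) := (pert_aeval hP p).1
  obtain ⟨h1, G, g1, g2, g3⟩ := pert_aeval (B := B + s • P) hP p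
  rw [hasDerivAt_iff_tendsto_slope_zero]
  have hlim : Filter.Tendsto (fun h => trL hP (G h)) (nhdsWithin 0 {0}ᶜ)
      (nhds (trL hP (G 0))) :=
    (((trL hP).continuous.comp g1).tendsto 0).mono_left nhdsWithin_le_nhds
  rw [trL_apply, g2] at hlim
  refine hlim.congr' ?_
  filter_upwards [self_mem_nhdsWithin] with h hh
  have e1 : trace e (aeval (B + (s + h) • P) p - aeval B p) -
      trace e (aeval (B + s • P) p - aeval B p) = h * trace e (G h * P) := by
    rw [← g3 h, ← trace_sub (hTC _) (hTC _)]
    congr 1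
    rw [add_smul, ← add_assoc]
    abel
  rw [e1, trL_apply, Complex.real_smul, ← mul_assoc]
  have : (h : ℂ) ≠ 0 := Complex.ofReal_ne_zero.2 hh
  push_cast
  rw [inv_mul_cancel₀ this, one_mul]

lemma eval_map_real (q : ℝ[X]) (x : ℝ) :
    (q.map (algebraMap ℝ ℂ)).eval (x : ℂ) = ((q.eval x : ℝ) : ℂ) := by
  rw [Polynomial.eval_map_algebraMap, ← Complex.coe_algebraMap, Polynomial.aeval_algebraMap_apply]
  simp

lemma aeval_nonneg {A : H →L[ℂ] H} (hA : IsSelfAdjoint A) (hs : spectrum ℝ A ⊆ Set.Icc a b)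
    (q : ℝ[X]) (hq : ∀ x ∈ Set.Icc a b, 0 ≤ q.eval x) : 0 ≤ aeval A (q.map (algebraMap ℝ ℂ)) := by
  rw [← fc_eval hA, fc_congr hA hs (g := fun x => ((q.eval x : ℝ) : ℂ))
    fun x _ => eval_map_real q x]
  exact fc_nonneg hA hs hq

lemma trace_mono (hB : IsSelfAdjoint B) (hP0 : 0 ≤ P) (hP : TC e P)
    (hs : spectrum ℝ B ⊆ Set.Icc a b) (hs' : spectrum ℝ (B + P) ⊆ Set.Icc a b) (q : ℝ[X])
    (hq : ∀ x ∈ Set.Icc a b, 0 ≤ (derivative q).eval x) :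
    0 ≤ (trace e (aeval (B + P) (q.map (algebraMap ℝ ℂ)) -
      aeval B (q.map (algebraMap ℝ ℂ)))).re := by
  generalize hp : q.map (algebraMap ℝ ℂ) = p
  have hpos : ∀ s ∈ Set.Icc (0:ℝ) 1, 0 ≤ (trace e (aeval (B + s • P) (derivative p) * P)).re := by
    intro s hs01
    refine trace_mul_nonneg ?_ hP0 hP
    have hss := spec_between hB hP0 hs hs' hs01
    rw [← hp, derivative_map]
    exact aeval_nonneg hss.1 hss.2 _ hq
  have hdr : ∀ s : ℝ, HasDerivAt (fun s : ℝ => (trace e (aeval (B + s • P) p - aeval B p)).re)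
      (trace e (aeval (B + s • P) (derivative p) * P)).re s := fun s =>
    (Complex.reCLM.hasFDerivAt).comp_hasDerivAt s (pert_deriv hP p s)
  have hmono : MonotoneOn (fun s : ℝ => (trace e (aeval (B + s • P) p - aeval B p)).re)
      (Set.Icc 0 1) := by
    refine monotoneOn_of_deriv_nonneg (convex_Icc 0 1)
      (fun s _ => (hdr s).continuousAt.continuousWithinAt)
      (fun s _ => (hdr s).differentiableAt.differentiableWithinAt) fun s hs' => ?_
    rw [(hdr s).deriv]
    rw [interior_Icc] at hs'
    exact hpos s (Set.Ioo_subset_Icc_self hs')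
  have h01 := hmono (Set.left_mem_Icc.2 zero_le_one) (Set.right_mem_Icc.2 zero_le_one) zero_le_one
  simp only [zero_smul, add_zero, sub_self, one_smul] at h01
  refine le_trans (le_of_eq ?_) h01
  simp [trace]
end mono

/-! ### Positivity against Poisson kernels -/
section poisson
variable {ι : Type*} {e : HilbertBasis ι ℂ H} {A X Y D2 : H →L[ℂ] H} {a b : ℝ}

lemma aeval_conj {U : H →L[ℂ] H} (h1 : U * adjoint U = 1) (h2 : adjoint U * U = 1)
    (B : H →L[ℂ] H) (p : ℂ[X]) : aeval (U * B * adjoint U) p = U * aeval B p * adjoint U := by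
  have hU : U ∈ unitary (H →L[ℂ] H) := ⟨h2, h1⟩
  have := Polynomial.aeval_algHom_apply
    (Unitary.conjStarAlgAut ℂ (H →L[ℂ] H) ⟨U, hU⟩ : (H →L[ℂ] H) ≃⋆ₐ[ℂ] (H →L[ℂ] H)).toAlgEquiv.toAlgHom B p
  exact this

lemma spec_conj {U : H →L[ℂ] H} (h1 : U * adjoint U = 1) (h2 : adjoint U * U = 1)
    (B : H →L[ℂ] H) : spectrum ℝ (U * B * adjoint U) = spectrum ℝ B :=
  Unitary.spectrum_star_right_conjugate (U := (⟨U, h2, h1⟩ : unitary (H →L[ℂ] H)))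

lemma TC_comm_aeval (hY : IsSelfAdjoint Y) (hsY : spectrum ℝ Y ⊆ Set.Icc a b)
    (hK : TC e (Y * X - X * Y)) (p : ℂ[X]) : TC e (aeval Y p * X - X * aeval Y p) := by
  have h := (onevar (e := e) (B := X) (A := Y) (Or.inr rfl) (φ := fun t : ℝ => p.eval (t : ℂ))
    ⟨p, fun _ => rfl⟩ hY hsY (by simpa using hK.neg)).1
  rw [fc_eval hY] at h
  simpa using h.neg

lemma conj_nonneg_op {P : H →L[ℂ] H} (hP : 0 ≤ P) (R : H →L[ℂ] H) : 0 ≤ R * P * adjoint R :=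
  star_right_conjugate_nonneg hP R

lemma pk_pos (hX : IsSelfAdjoint X) (hY : IsSelfAdjoint Y) (hsX : spectrum ℝ X ⊆ Set.Icc a b)
    (hsY : spectrum ℝ Y ⊆ Set.Icc a b) (hD : Y * X - X * Y = Complex.I • D2) (hD0 : 0 ≤ D2)
    (hDT : TC e D2) (q : ℝ[X]) (hq : ∀ x ∈ Set.Icc a b, 0 ≤ (derivative q).eval x)
    {ε : ℝ} (hε : 0 < ε) (t : ℝ) :
    0 ≤ (trace e (fc (fun x => (pk ε t x : ℂ)) X *
      ((-Complex.I) • (aeval Y (q.map (algebraMap ℝ ℂ)) * X -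
        X * aeval Y (q.map (algebraMap ℝ ℂ)))))).re := by
  generalize hp : q.map (algebraMap ℝ ℂ) = p
  obtain ⟨U, R, h1, h2, h3, h4⟩ := exists_cayley hX hsX hε t
  have hK : TC e (Y * X - X * Y) := hD ▸ hDT.smul _
  have hC : TC e (aeval Y p * X - X * aeval Y p) := TC_comm_aeval hY hsY hK p
  set P : H →L[ℂ] H := (2 * ε) • (R * D2 * adjoint R) with hPdef
  have hP0 : 0 ≤ P := rsmul_nonneg (conj_nonneg_op hD0 R) (by positivity)
  have hPT : TC e P := by
    rw [hPdef, ← Complex.coe_smul]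
    exact ((hDT.mul_left R).mul_right _).smul _
  have hUY : U * Y * adjoint U = Y + P := by
    rw [← sub_eq_iff_eq_add', h4 Y, hD, mul_smul_comm, smul_mul_assoc, smul_smul, hPdef,
      ← Complex.coe_smul]
    congr 1
    push_cast
    linear_combination (-2 * (ε : ℂ)) * Complex.I_sq
  have hm := trace_mono hY hP0 hPT hsY (by rw [← hUY, spec_conj h1 h2]; exact hsY) q hq
  rw [hp, ← hUY, aeval_conj h1 h2, h4, trace_smul, trace_mul_comm (hC.mul_left R), ← mul_assoc] at hm
  rw [← h3, smul_mul_assoc, mul_smul_comm, trace_smul, trace_smul]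
  generalize trace e (adjoint R * R * ((aeval Y) p * X - X * (aeval Y) p)) = z at hm ⊢
  have : (ε : ℂ) * (-Complex.I * z) = ((1/2 : ℝ) : ℂ) * (-(2 * Complex.I * ε) * z) := by
    push_cast; ring
  rw [this, Complex.re_ofReal_mul]
  positivity

lemma cfc_cont_param (hA : IsSelfAdjoint A) (hs : spectrum ℝ A ⊆ Set.Icc a b) {G : ℝ → ℝ → ℝ}
    (hG : Continuous (fun q : ℝ × ℝ => G q.1 q.2)) : Continuous fun ε => cfc (G ε) A := by
  rw [continuous_iff_continuousAt]
  intro ε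
  have hu : TendstoUniformlyOn G (G ε) (nhds ε) (Set.Icc a b) := by
    rw [tendstoUniformlyOn_iff_tendstoUniformly_comp_coe]
    refine ContinuousOn.tendstoUniformly (f := fun ε (x : Set.Icc a b) => G ε x) (U := Set.univ)
      Filter.univ_mem ?_
    refine Continuous.continuousOn ?_
    exact hG.comp (continuous_fst.prodMk (continuous_subtype_val.comp continuous_snd))
  refine tendsto_cfc_fun (hu.mono hs) (Filter.Eventually.of_forall fun x => ?_)
  exact (hG.comp (Continuous.prodMk_right x)).continuousOn

lemma poisson_cov (f : ℝ → ℝ) {ε : ℝ} (hε : 0 < ε) (x : ℝ) :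
    ∫ u, f (x + ε * u) * (1 + u ^ 2)⁻¹ = ∫ t, f t * pk ε t x := by
  have h1 := integral_add_left_eq_self (μ := volume) (fun t => f t * pk ε t x) x
  rw [← h1]
  have h2 := Measure.integral_comp_mul_left (fun t => f (x + t) * pk ε (x + t) x) ε
  rw [abs_of_pos (inv_pos.2 hε), smul_eq_mul] at h2
  have h3 : ∫ t, f (x + t) * pk ε (x + t) x = ε * ∫ u, f (x + ε * u) * pk ε (x + ε * u) x := by
    rw [h2, ← mul_assoc, mul_inv_cancel₀ hε.ne', one_mul]
  rw [h3, ← integral_const_mul]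
  congr 1
  funext u
  simp only [pk]
  have : (1 + u ^ 2) ≠ 0 := by positivity
  have h5 : (x - (x + ε * u)) ^ 2 + ε ^ 2 = ε ^ 2 * (1 + u ^ 2) := by ring
  rw [h5]
  field_simp

lemma poisson (hA : IsSelfAdjoint A) (hs : spectrum ℝ A ⊆ Set.Icc a b)
    (L : (H →L[ℂ] H) →L[ℝ] ℝ) (M : ℝ)
    (hL : ∀ ε : ℝ, 0 < ε → ∀ t, L (fc (fun x => (pk ε t x : ℂ)) A) ≤ M) {f : ℝ → ℝ}
    (hf : Continuous f) (hc : HasCompactSupport f) (h0 : ∀ x, 0 ≤ f x) :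
    L (fc (fun x => (f x : ℂ)) A) ≤ M / Real.pi * ∫ t, f t := by
  obtain ⟨C, hC⟩ := hf.bounded_above_of_compact_support hc
  set G : ℝ → ℝ → ℝ := fun ε x => ∫ u, f (x + ε * u) * (1 + u ^ 2)⁻¹ with hGdef
  have hG : Continuous (fun q : ℝ × ℝ => G q.1 q.2) := by
    refine continuous_of_dominated (bound := fun u => C * (1 + u ^ 2)⁻¹) (fun q => ?_) (fun q => ?_)
      (integrable_inv_one_add_sq.const_mul C) (Filter.Eventually.of_forall fun u => by fun_prop)
    · refine Continuous.aestronglyMeasurable ?_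
      exact (by fun_prop : Continuous fun u => f (q.2 + q.1 * u)).mul
        (Continuous.inv₀ (by fun_prop) fun u => by positivity)
    · refine Filter.Eventually.of_forall fun u => ?_
      rw [norm_mul, Real.norm_of_nonneg (by positivity : (0:ℝ) ≤ (1 + u ^ 2)⁻¹)]
      exact mul_le_mul_of_nonneg_right (hC _) (by positivity)
  have hG0 : G 0 = fun x => Real.pi * f x := by
    funext x
    simp only [hGdef, zero_mul, add_zero]
    rw [integral_const_mul, integral_univ_inv_one_add_sq, mul_comm]
  have hfi : Integrable f := hf.integrable_of_hasCompactSupport hc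
  have hpos : ∀ ε : ℝ, 0 < ε → L (cfc (G ε) A) ≤ M * ∫ t, f t := by
    intro ε hε
    have e1 : G ε = fun x => ∫ t, f t * pk ε t x := by
      funext x; exact poisson_cov f hε x
    have hjc : Continuous (fun q : ℝ × ℝ => f q.1 * pk ε q.1 q.2) := by
      refine (hf.comp continuous_fst).mul ?_
      unfold pk
      exact Continuous.div (by fun_prop) (by fun_prop) fun q => (pk_den hε q.1 q.2).ne'
    have hbd : ∀ t x, ‖f t * pk ε t x‖ ≤ ‖f t‖ * ε⁻¹ := by
      intro t x
      rw [norm_mul]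
      refine mul_le_mul_of_nonneg_left ?_ (norm_nonneg _)
      have := pk_den hε t x
      rw [pk, Real.norm_of_nonneg (by positivity), div_le_iff₀ this, inv_mul_eq_div, le_div_iff₀ hε]
      nlinarith [sq_nonneg (x - t)]
    have hbi : Integrable (fun t => ‖f t‖ * ε⁻¹) := hfi.norm.mul_const _
    have e2 : cfc (G ε) A = ∫ t, cfc (fun x => f t * pk ε t x) A := by
      rw [e1]
      exact cfc_integral (fun t x => f t * pk ε t x) (fun t => ‖f t‖ * ε⁻¹) A hjc.continuousOn
        (Filter.Eventually.of_forall fun t x _ => hbd t x) hbi.2 hA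
    have hInt : Integrable fun t => cfc (fun x => f t * pk ε t x) A :=
      integrable_cfc (fun t x => f t * pk ε t x) (fun t => ‖f t‖ * ε⁻¹) A hjc.continuousOn
        (Filter.Eventually.of_forall fun t x _ => hbd t x) hbi.2 hA
    rw [e2, ← ContinuousLinearMap.integral_comp_comm L hInt, ← integral_const_mul]
    refine integral_mono (L.integrable_comp hInt) (hfi.const_mul M) fun t => ?_
    have : cfc (fun x => f t * pk ε t x) A = f t • fc (fun x => (pk ε t x : ℂ)) A := by
      rw [fc_ofReal hA, cfc_const_mul _ _ A (pk_cont hε t).continuousOn]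
    simp only [this, map_smul, smul_eq_mul]
    rw [mul_comm]
    exact mul_le_mul_of_nonneg_right (hL ε hε t) (h0 t)
  have hcont : Continuous fun ε => L (cfc (G ε) A) := L.continuous.comp (cfc_cont_param hA hs hG)
  have hlim : L (cfc (G 0) A) ≤ M * ∫ t, f t := by
    refine le_of_tendsto ((hcont.tendsto 0).mono_left (nhdsWithin_le_nhds (s := Set.Ioi 0))) ?_
    filter_upwards [self_mem_nhdsWithin] with ε hε using hpos ε hε
  rw [hG0, cfc_const_mul _ _ A hf.continuousOn, map_smul, smul_eq_mul] at hlim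
  rw [fc_ofReal hA, div_mul_eq_mul_div, le_div_iff₀ Real.pi_pos, mul_comm]
  exact hlim
end poisson

/-! ### Positivity of the functionals -/
section posi
variable {ι : Type*} {e : HilbertBasis ι ℂ H} {A X Y D2 : H →L[ℂ] H} {a b : ℝ}

lemma ext_cc (hab : a ≤ b) {f : ℝ → ℝ} (hf : ContinuousOn f (Set.Icc a b))
    (h0 : ∀ x ∈ Set.Icc a b, 0 ≤ f x) : ∃ F : ℝ → ℝ, Continuous F ∧ HasCompactSupport F ∧
      (∀ x, 0 ≤ F x) ∧ Set.EqOn F f (Set.Icc a b) := by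
  set pr : ℝ → ℝ := fun x => (Set.projIcc a b hab x : ℝ) with hpr
  have hprc : Continuous pr := continuous_subtype_val.comp continuous_projIcc
  have hprm : ∀ x, pr x ∈ Set.Icc a b := fun x => (Set.projIcc a b hab x).2
  have hpre : ∀ x ∈ Set.Icc a b, pr x = x := fun x hx => by
    simp only [hpr]; rw [Set.projIcc_of_mem hab hx]
  refine ⟨fun x => f (pr x) * max 0 (1 - |x - pr x|), ?_, ?_, ?_, ?_⟩
  · exact (hf.comp_continuous hprc hprm).mul (by fun_prop)
  · refine HasCompactSupport.intro (isCompact_Icc (a := a - 1) (b := b + 1)) fun x hx => ?_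
    have : 1 - |x - pr x| ≤ 0 := by
      by_contra hlt
      push Not at hlt
      have h1 : |x - pr x| < 1 := by linarith
      rw [abs_lt] at h1
      have := hprm x
      exact hx ⟨by linarith [this.1, h1.1], by linarith [this.2, h1.2]⟩
    rw [max_eq_left this, mul_zero]
  · intro x
    exact mul_nonneg (h0 _ (hprm x)) (le_max_left _ _)
  · intro x hx
    simp only [hpre x hx]
    simp

lemma poisson_zero (hab : a ≤ b) (hA : IsSelfAdjoint A) (hs : spectrum ℝ A ⊆ Set.Icc a b)
    (L : (H →L[ℂ] H) →L[ℝ] ℝ)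
    (hL : ∀ ε : ℝ, 0 < ε → ∀ t, 0 ≤ L (fc (fun x => (pk ε t x : ℂ)) A)) {f : ℝ → ℝ}
    (hf : ContinuousOn f (Set.Icc a b)) (h0 : ∀ x ∈ Set.Icc a b, 0 ≤ f x) :
    0 ≤ L (fc (fun x => (f x : ℂ)) A) := by
  obtain ⟨F, h1, h2, h3, h4⟩ := ext_cc hab hf h0
  have := poisson hA hs (-L) 0 (fun ε hε t => by
    rw [_root_.neg_apply]; exact neg_nonpos.2 (hL ε hε t)) h1 h2 h3
  rw [zero_div, zero_mul, _root_.neg_apply, neg_nonpos] at this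
  rw [fc_congr hA hs (g := fun x => (F x : ℂ)) fun x hx => by simp only [h4 hx]]
  exact this

lemma fac (hA : AssumptionA e X Y D2 a b) :
    Y * X - X * Y = Complex.I • D2 ∧ 0 ≤ D2 ∧ TC e D2 := by
  refine ⟨?_, (ContinuousLinearMap.nonneg_iff_isPositive _).2 hA.hpos, nuc_of_isTraceClass e hA.htc⟩
  have h := hA.hD2
  have h2 : (Complex.I / 2) • ((2 : ℂ) • D2) = Complex.I • D2 := by
    rw [smul_smul]; congr 1; ring
  rw [← h2, h, smul_smul]
  have : Complex.I / 2 * (-2 * Complex.I) = 1 := by linear_combination (-1 : ℂ) * Complex.I_sq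
  rw [this, one_smul]

lemma adj_aeval (hY : IsSelfAdjoint Y) (q : ℝ[X]) :
    adjoint (aeval Y (q.map (algebraMap ℝ ℂ))) = aeval Y (q.map (algebraMap ℝ ℂ)) := by
  rw [← fc_eval hY, fc_adjoint]
  congr 1
  funext x
  rw [eval_map_real, Complex.conj_ofReal]

lemma tr_real {W : H →L[ℂ] H} (hX : IsSelfAdjoint X) (hW : adjoint W = W)
    (hC : TC e (W * X - X * W)) (g : ℝ → ℝ) :
    (trace e (fc (fun x => (g x : ℂ)) X * ((-Complex.I) • (W * X - X * W)))).im = 0 := by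
  have h1 : star (fc (fun x => (g x : ℂ)) X) = fc (fun x => (g x : ℂ)) X := by
    rw [ContinuousLinearMap.star_eq_adjoint, fc_adjoint]
    simp only [Complex.conj_ofReal]
  have h2 : star ((-Complex.I) • (W * X - X * W)) = (-Complex.I) • (W * X - X * W) := by
    rw [← ContinuousLinearMap.star_eq_adjoint] at hW
    rw [star_smul, star_sub, star_mul, star_mul, hW, hX.star_eq, star_neg, ← neg_sub (W * X),
      smul_neg, ← neg_smul]
    simp
  rw [← Complex.conj_eq_iff_im, ← trace_adjoint, ← ContinuousLinearMap.star_eq_adjoint, star_mul,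
    h1, h2, trace_mul_comm (hC.smul _)]

lemma tr_pos (hA : AssumptionA e X Y D2 a b) (q : ℝ[X])
    (hq : ∀ x ∈ Set.Icc a b, 0 ≤ (derivative q).eval x) {g : ℝ → ℝ}
    (hg : ContinuousOn g (Set.Icc a b)) (hg0 : ∀ x ∈ Set.Icc a b, 0 ≤ g x) :
    0 ≤ (trace e (fc (fun x => (g x : ℂ)) X *
      ((-Complex.I) • (aeval Y (q.map (algebraMap ℝ ℂ)) * X -
        X * aeval Y (q.map (algebraMap ℝ ℂ)))))).re := by
  obtain ⟨h1, h2, h3⟩ := fac hA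
  have hC := (TC_comm_aeval hA.hY hA.hspecY (h1 ▸ h3.smul _) (q.map (algebraMap ℝ ℂ))).smul
    (-Complex.I)
  exact poisson_zero hA.hab hA.hX hA.hspecX
    (Complex.reCLM.comp ((trL hC).restrictScalars ℝ))
    (fun ε hε t => pk_pos hA.hX hA.hY hA.hspecX hA.hspecY h1 h2 h3 q hq hε t) hg hg0

lemma exists_antideriv (p : ℝ[X]) : ∃ q, derivative q = p := by
  induction p using Polynomial.induction_on' with
  | add p q hp hq =>
    obtain ⟨p', rfl⟩ := hp
    obtain ⟨q', rfl⟩ := hq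
    exact ⟨p' + q', derivative_add⟩
  | monomial n c =>
    refine ⟨monomial (n + 1) (c / (n + 1)), ?_⟩
    rw [derivative_monomial, Nat.add_sub_cancel]
    congr 1
    push_cast
    have : (n + 1 : ℝ) ≠ 0 := by positivity
    field_simp

/-- A functional which is nonnegative on nonnegative polynomials is positive. -/
lemma poly_pos (hA : IsSelfAdjoint A) (hs : spectrum ℝ A ⊆ Set.Icc a b)
    (L : (H →L[ℂ] H) →L[ℝ] ℝ)
    (hL : ∀ q : ℝ[X], (∀ x ∈ Set.Icc a b, 0 ≤ q.eval x) →
      0 ≤ L (fc (fun x => ((q.eval x : ℝ) : ℂ)) A)) {f : ℝ → ℝ}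
    (hf : ContinuousOn f (Set.Icc a b)) (h0 : ∀ x ∈ Set.Icc a b, 0 ≤ f x) :
    0 ≤ L (fc (fun x => (f x : ℂ)) A) := by
  have key : ∀ δ : ℝ, 0 < δ → -(‖L‖ * (2 * δ)) ≤ L (fc (fun x => (f x : ℂ)) A) := by
    intro δ hδ
    obtain ⟨p, hp⟩ := exists_polynomial_near_of_continuousOn a b f hf δ hδ
    have h1 := hL (p + C δ) fun x hx => by
      have := abs_lt.1 (hp x hx)
      have := h0 x hx
      simp only [eval_add, eval_C]; linarith
    have h2 : ‖fc (fun x => (((p + C δ).eval x : ℝ) : ℂ)) A - fc (fun x => (f x : ℂ)) A‖ ≤ 2 * δ := by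
      refine fc_dist_le hA hs ?_ ?_ (by positivity) fun x hx => ?_
      · exact (Complex.continuous_ofReal.comp (p + C δ).continuous).continuousOn
      · exact Complex.continuous_ofReal.comp_continuousOn hf
      · have := abs_lt.1 (hp x hx)
        rw [← Complex.ofReal_sub, Complex.norm_real, Real.norm_eq_abs, abs_le]
        simp only [eval_add, eval_C]
        constructor <;> linarith
    have h3 := (L.le_opNorm _).trans (mul_le_mul_of_nonneg_left h2 (norm_nonneg L))
    rw [map_sub, Real.norm_eq_abs] at h3
    linarith [(abs_le.1 h3).2]
  have hlim : Filter.Tendsto (fun δ : ℝ => -(‖L‖ * (2 * δ))) (nhdsWithin 0 (Set.Ioi 0))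
      (nhds (-(‖L‖ * (2 * 0)))) :=
    ((by fun_prop : Continuous fun δ : ℝ => -(‖L‖ * (2 * δ))).tendsto 0).mono_left nhdsWithin_le_nhds
  rw [mul_zero, mul_zero, neg_zero] at hlim
  refine le_of_tendsto hlim ?_
  filter_upwards [self_mem_nhdsWithin] with δ hδ using key δ hδ

lemma K0_TC (hA : AssumptionA e X Y D2 a b) {P : (ℝ → ℂ) → Prop} (hP : P = MemC11 ∨ P = IsPolyFun)
    {φ : ℝ → ℂ} (hφ : P φ) : TC e (Y * fc φ X - fc φ X * Y) := by
  obtain ⟨h1, h2, h3⟩ := fac hA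
  exact (onevar hP hφ hA.hX hA.hspecX (h1 ▸ h3.smul _)).1

lemma K0_trace (hA : AssumptionA e X Y D2 a b) {P : (ℝ → ℂ) → Prop}
    (hP : P = MemC11 ∨ P = IsPolyFun) {φ : ℝ → ℂ} (hφ : P φ) :
    -Complex.I * trace e (Y * fc φ X - fc φ X * Y) = trace e (fc (deriv φ) X * D2) := by
  obtain ⟨h1, h2, h3⟩ := fac hA
  rw [(onevar hP hφ hA.hX hA.hspecX (h1 ▸ h3.smul _)).2, h1, mul_smul_comm, trace_smul, ← mul_assoc]
  simp

lemma key_id (hA : AssumptionA e X Y D2 a b) {P : (ℝ → ℂ) → Prop} (hP : P = MemC11 ∨ P = IsPolyFun)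
    {φ : ℝ → ℂ} (hφ : P φ) {P' : (ℝ → ℂ) → Prop} (hP' : P' = MemC11 ∨ P' = IsPolyFun)
    {ψ : ℝ → ℂ} (hψ : P' ψ) :
    trace e (fc ψ Y * fc φ X - fc φ X * fc ψ Y) =
      trace e (fc (deriv ψ) Y * (Y * fc φ X - fc φ X * Y)) := by
  have h := (onevar hP' hψ hA.hY hA.hspecY (e := e) (B := fc φ X)
    (by simpa using (K0_TC hA hP hφ).neg)).2
  rw [← neg_sub, trace_neg, h, ← trace_neg, ← mul_neg, neg_sub]

lemma key_q (hA : AssumptionA e X Y D2 a b) {P : (ℝ → ℂ) → Prop} (hP : P = MemC11 ∨ P = IsPolyFun)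
    {φ : ℝ → ℂ} (hφ : P φ) (q : ℝ[X]) :
    -Complex.I * trace e (fc (fun x => (((derivative q).eval x : ℝ) : ℂ)) Y *
      (Y * fc φ X - fc φ X * Y)) = trace e (fc (deriv φ) X *
      ((-Complex.I) • (aeval Y (q.map (algebraMap ℝ ℂ)) * X -
        X * aeval Y (q.map (algebraMap ℝ ℂ))))) ∧
    trace e (fc (fun x => (((derivative q).eval x : ℝ) : ℂ)) Y * D2) =
      trace e ((-Complex.I) • (aeval Y (q.map (algebraMap ℝ ℂ)) * X -
        X * aeval Y (q.map (algebraMap ℝ ℂ)))) := by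
  obtain ⟨h1, h2, h3⟩ := fac hA
  set p := q.map (algebraMap ℝ ℂ) with hp
  have hK : TC e (Y * X - X * Y) := h1 ▸ h3.smul _
  have hd : (fun x : ℝ => (((derivative q).eval x : ℝ) : ℂ)) = deriv fun t : ℝ => p.eval (t : ℂ) := by
    rw [deriv_eval]
    funext x
    rw [hp, derivative_map, eval_map_real]
  have hψ : IsPolyFun fun t : ℝ => p.eval (t : ℂ) := ⟨p, fun _ => rfl⟩
  have hC := TC_comm_aeval hA.hY hA.hspecY hK p
  constructor
  · rw [hd, ← key_id hA hP hφ (Or.inr rfl) hψ, fc_eval hA.hY,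
      (onevar hP hφ hA.hX hA.hspecX hC).2, mul_smul_comm, trace_smul]
  · have h := (onevar (Or.inr rfl) hψ hA.hY hA.hspecY (e := e) (B := X)
      (by simpa using hK.neg)).2
    have hD : D2 = (-Complex.I) • (Y * X - X * Y) := by
      rw [h1, smul_smul]; simp
    rw [fc_eval hA.hY] at h
    conv_lhs => rw [hD]
    rw [hd, mul_smul_comm, trace_smul, trace_smul, ← neg_sub (X * Y), mul_neg, trace_neg, ← h,
      ← trace_neg, neg_sub]

lemma split_trace (hX : IsSelfAdjoint X) (hs : spectrum ℝ X ⊆ Set.Icc a b)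
    {C : H →L[ℂ] H} (hC : TC e C) {w : ℝ → ℂ} (hw : Continuous w) :
    trace e (fc w X * C) = trace e (fc (fun x => ((w x).re : ℂ)) X * C) +
      Complex.I * trace e (fc (fun x => ((w x).im : ℂ)) X * C) := by
  have h1 : Continuous (fun x => ((w x).re : ℂ)) := by fun_prop
  have h2 : Continuous (fun x => ((w x).im : ℂ)) := by fun_prop
  have : fc w X = fc (fun x => ((w x).re : ℂ)) X + Complex.I • fc (fun x => ((w x).im : ℂ)) X := by
    rw [← fc_const_mul hX hs _ h2.continuousOn, ← fc_add hX hs h1.continuousOn (by fun_prop)]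
    congr 1
    funext x
    rw [mul_comm, Complex.re_add_im]
  rw [this, add_mul, smul_mul_assoc, trace_add (hC.mul_left _) ((hC.mul_left _).smul _), trace_smul]

lemma trace_bound (hA : AssumptionA e X Y D2 a b) (q : ℝ[X])
    (hq : ∀ x ∈ Set.Icc a b, 0 ≤ (derivative q).eval x) {g : ℝ → ℝ} (hg : Continuous g) {m : ℝ}
    (hm : ∀ x ∈ Set.Icc a b, |g x| ≤ m) :
    |(trace e (fc (fun x => (g x : ℂ)) X *
      ((-Complex.I) • (aeval Y (q.map (algebraMap ℝ ℂ)) * X -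
        X * aeval Y (q.map (algebraMap ℝ ℂ)))))).re| ≤
    m * (trace e ((-Complex.I) • (aeval Y (q.map (algebraMap ℝ ℂ)) * X -
        X * aeval Y (q.map (algebraMap ℝ ℂ))))).re := by
  have hp1 := tr_pos hA q hq (g := fun x => m - g x) (by fun_prop) fun x hx => by
    linarith [(abs_le.1 (hm x hx)).2]
  have hp2 := tr_pos hA q hq (g := fun x => m + g x) (by fun_prop) fun x hx => by
    linarith [(abs_le.1 (hm x hx)).1]
  obtain ⟨h1, h2, h3⟩ := fac hA
  have hC := (TC_comm_aeval hA.hY hA.hspecY (h1 ▸ h3.smul _) (q.map (algebraMap ℝ ℂ))).smul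
    (-Complex.I)
  generalize ((-Complex.I) • (aeval Y (q.map (algebraMap ℝ ℂ)) * X -
        X * aeval Y (q.map (algebraMap ℝ ℂ)))) = C at *
  simp only [Complex.ofReal_sub, Complex.ofReal_add] at hp1 hp2
  rw [fc_sub hA.hX hA.hspecX (by fun_prop) (by fun_prop), sub_mul,
    trace_sub (hC.mul_left _) (hC.mul_left _), fc_const hA.hX, smul_mul_assoc, one_mul, trace_smul,
    Complex.sub_re, Complex.re_ofReal_mul] at hp1
  rw [fc_add hA.hX hA.hspecX (by fun_prop) (by fun_prop), add_mul,
    trace_add (hC.mul_left _) (hC.mul_left _), fc_const hA.hX, smul_mul_assoc, one_mul, trace_smul,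
    Complex.add_re, Complex.re_ofReal_mul] at hp2
  rw [abs_le]
  constructor <;> linarith

/-- The functional `Z ↦ -i Tr (Z K)`. -/
noncomputable def Lam {K : H →L[ℂ] H} (hK : TC e K) : (H →L[ℂ] H) →L[ℂ] ℂ := (-Complex.I) • trL hK

lemma Lam_apply {K : H →L[ℂ] H} (hK : TC e K) (Z : H →L[ℂ] H) :
    Lam hK Z = -Complex.I * trace e (Z * K) := rfl

noncomputable def LamRe {K : H →L[ℂ] H} (hK : TC e K) : (H →L[ℂ] H) →L[ℝ] ℝ :=
  Complex.reCLM.comp ((Lam hK).restrictScalars ℝ)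

noncomputable def LamIm {K : H →L[ℂ] H} (hK : TC e K) : (H →L[ℂ] H) →L[ℝ] ℝ :=
  Complex.imCLM.comp ((Lam hK).restrictScalars ℝ)

noncomputable def nu {D : H →L[ℂ] H} (hD : TC e D) : (H →L[ℂ] H) →L[ℝ] ℝ :=
  Complex.reCLM.comp ((trL hD).restrictScalars ℝ)

lemma main_pos (hA : AssumptionA e X Y D2 a b) {P : (ℝ → ℂ) → Prop}
    (hP : P = MemC11 ∨ P = IsPolyFun) {φ : ℝ → ℂ} (hφ : P φ)
    (hK : TC e (Y * fc φ X - fc φ X * Y)) (hD : TC e D2) {m : ℝ}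
    (hm : ∀ x ∈ Set.Icc a b, ‖deriv φ x‖ ≤ m) {f : ℝ → ℝ}
    (hf : ContinuousOn f (Set.Icc a b)) (h0 : ∀ x ∈ Set.Icc a b, 0 ≤ f x) :
    |LamRe hK (fc (fun x => (f x : ℂ)) Y)| ≤ m * nu hD (fc (fun x => (f x : ℂ)) Y) ∧
    |LamIm hK (fc (fun x => (f x : ℂ)) Y)| ≤ m * nu hD (fc (fun x => (f x : ℂ)) Y) ∧
    ((∀ t ∈ Set.Icc a b, ∃ c : ℝ, 0 ≤ c ∧ deriv φ t = (c : ℂ)) →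
      0 ≤ LamRe hK (fc (fun x => (f x : ℂ)) Y) ∧ LamIm hK (fc (fun x => (f x : ℂ)) Y) = 0) := by
  have hdc : Continuous (deriv φ) := (P_contDiff hP hφ).2
  obtain ⟨h1, h2, h3⟩ := fac hA
  have hrb : ∀ x ∈ Set.Icc a b, |(deriv φ x).re| ≤ m := fun x hx =>
    (Complex.abs_re_le_norm _).trans (hm x hx)
  have hib : ∀ x ∈ Set.Icc a b, |(deriv φ x).im| ≤ m := fun x hx =>
    (Complex.abs_im_le_norm _).trans (hm x hx)
  -- polynomials
  have hpoly : ∀ p : ℝ[X], (∀ x ∈ Set.Icc a b, 0 ≤ p.eval x) →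
      |LamRe hK (fc (fun x => ((p.eval x : ℝ) : ℂ)) Y)| ≤
        m * nu hD (fc (fun x => ((p.eval x : ℝ) : ℂ)) Y) ∧
      |LamIm hK (fc (fun x => ((p.eval x : ℝ) : ℂ)) Y)| ≤
        m * nu hD (fc (fun x => ((p.eval x : ℝ) : ℂ)) Y) ∧
      ((∀ t ∈ Set.Icc a b, ∃ c : ℝ, 0 ≤ c ∧ deriv φ t = (c : ℂ)) →
        0 ≤ LamRe hK (fc (fun x => ((p.eval x : ℝ) : ℂ)) Y) ∧
        LamIm hK (fc (fun x => ((p.eval x : ℝ) : ℂ)) Y) = 0) := by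
    intro p hp
    obtain ⟨q, rfl⟩ := exists_antideriv p
    obtain ⟨k1, k2⟩ := key_q hA hP hφ q
    have hC := TC_comm_aeval hA.hY hA.hspecY (h1 ▸ h3.smul _ : TC e (Y * X - X * Y))
      (q.map (algebraMap ℝ ℂ))
    have r1 := tr_real hA.hX (adj_aeval hA.hY q) hC (fun x => (deriv φ x).re)
    have r2 := tr_real hA.hX (adj_aeval hA.hY q) hC (fun x => (deriv φ x).im)
    have b1 := trace_bound hA q hp (g := fun x => (deriv φ x).re) (by fun_prop) hrb
    have b2 := trace_bound hA q hp (g := fun x => (deriv φ x).im) (by fun_prop) hib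
    have sp := split_trace hA.hX hA.hspecX (hC.smul (-Complex.I)) hdc
    have e1 : LamRe hK (fc (fun x => (((derivative q).eval x : ℝ) : ℂ)) Y) =
      (-Complex.I * trace e (fc (fun x => (((derivative q).eval x : ℝ) : ℂ)) Y *
      (Y * fc φ X - fc φ X * Y))).re := rfl
    have e2 : LamIm hK (fc (fun x => (((derivative q).eval x : ℝ) : ℂ)) Y) =
      (-Complex.I * trace e (fc (fun x => (((derivative q).eval x : ℝ) : ℂ)) Y *
      (Y * fc φ X - fc φ X * Y))).im := rfl
    have e3 : nu hD (fc (fun x => (((derivative q).eval x : ℝ) : ℂ)) Y) =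
      (trace e (fc (fun x => (((derivative q).eval x : ℝ) : ℂ)) Y * D2)).re := rfl
    rw [e1, e2, e3, k1, k2, sp]
    simp only [Complex.add_re, Complex.add_im, Complex.I_mul_re, Complex.I_mul_im, r1, r2, neg_zero,
      add_zero, zero_add]
    refine ⟨b1, b2, fun hpos => ⟨?_, ?_⟩⟩
    · refine tr_pos hA q hp (by fun_prop) fun x hx => ?_
      obtain ⟨c, hc, hc'⟩ := hpos x hx
      rw [hc']; simpa using hc
    · rw [fc_congr hA.hX hA.hspecX (g := fun _ => 0)]
      · rw [fc_const hA.hX]; simp [trace]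
      · intro x hx
        obtain ⟨c, hc, hc'⟩ := hpos x hx
        simp only [hc', Complex.ofReal_im, Complex.ofReal_zero]
  have pp := fun L hL => poly_pos hA.hY hA.hspecY L hL hf h0
  have q1 := pp (m • nu hD - LamRe hK) fun q hq => by
    have := (abs_le.1 (hpoly q hq).1).2
    simp only [_root_.sub_apply, _root_.smul_apply, smul_eq_mul]; linarith
  have q2 := pp (m • nu hD + LamRe hK) fun q hq => by
    have := (abs_le.1 (hpoly q hq).1).1
    simp only [_root_.add_apply, _root_.smul_apply, smul_eq_mul]; linarith
  have q3 := pp (m • nu hD - LamIm hK) fun q hq => by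
    have := (abs_le.1 (hpoly q hq).2.1).2
    simp only [_root_.sub_apply, _root_.smul_apply, smul_eq_mul]; linarith
  have q4 := pp (m • nu hD + LamIm hK) fun q hq => by
    have := (abs_le.1 (hpoly q hq).2.1).1
    simp only [_root_.add_apply, _root_.smul_apply, smul_eq_mul]; linarith
  simp only [_root_.add_apply, _root_.sub_apply, _root_.smul_apply, smul_eq_mul] at q1 q2 q3 q4
  refine ⟨abs_le.2 ⟨by linarith, by linarith⟩, abs_le.2 ⟨by linarith, by linarith⟩, fun hpos => ?_⟩
  have q5 := pp (LamRe hK) fun q hq => ((hpoly q hq).2.2 hpos).1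
  have q6 := pp (LamIm hK) fun q hq => ((hpoly q hq).2.2 hpos).2.ge
  have q7 := pp (-LamIm hK) fun q hq => by
    rw [_root_.neg_apply, ((hpoly q hq).2.2 hpos).2, neg_zero]
  rw [_root_.neg_apply] at q7
  exact ⟨q5, by linarith⟩

lemma nu_pos (hY : IsSelfAdjoint Y) (hs : spectrum ℝ Y ⊆ Set.Icc a b) (hD0 : 0 ≤ D2)
    (hD : TC e D2) {f : ℝ → ℝ} (h0 : ∀ x ∈ Set.Icc a b, 0 ≤ f x) :
    0 ≤ nu hD (fc (fun x => (f x : ℂ)) Y) :=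
  trace_mul_nonneg (fc_nonneg hY hs h0) hD0 hD
end posi

/-! ### Absolute continuity: the Kato type bound -/
section kato
variable {ι : Type*} {e : HilbertBasis ι ℂ H} {A X Y D2 : H →L[ℂ] H} {a b : ℝ}

noncomputable def quad (v : H) : (H →L[ℂ] H) →L[ℝ] ℝ :=
  Complex.reCLM.comp (((innerSL ℂ v).comp (ContinuousLinearMap.apply ℂ H v)).restrictScalars ℝ)

lemma quad_apply (v : H) (Z : H →L[ℂ] H) : quad v Z = (⟪v, Z v⟫_ℂ).re := rfl

lemma norm_le_one_of_unitary {U : H →L[ℂ] H} (h : adjoint U * U = 1) : ‖U‖ ≤ 1 := by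
  refine ContinuousLinearMap.opNorm_le_bound _ zero_le_one fun x => ?_
  have h1 : ‖U x‖ ^ 2 = ‖x‖ ^ 2 := by
    rw [← inner_self_eq_norm_sq (𝕜 := ℂ), ← ContinuousLinearMap.adjoint_inner_left,
      ← mul_apply_eq_comp, h, ← inner_self_eq_norm_sq (𝕜 := ℂ)]
    rfl
  rw [one_mul]
  exact le_of_eq ((sq_eq_sq₀ (norm_nonneg _) (norm_nonneg _)).1 h1)

lemma kato_pk (hA : AssumptionA e X Y D2 a b) {D : H →L[ℂ] H} (hDa : adjoint D = D)
    (hDD : D * D = D2) (v : H) (hv : ‖v‖ = 1) {ε : ℝ} (hε : 0 < ε) (t : ℝ) :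
    quad (D v) (fc (fun x => (pk ε t x : ℂ)) Y) ≤ ‖X‖ := by
  obtain ⟨U, R, h1, h2, h3, h4⟩ := exists_cayley hA.hY hA.hspecY hε t
  obtain ⟨k1, k2, k3⟩ := fac hA
  have hXY : X * Y - Y * X = (-Complex.I) • D2 := by rw [← neg_sub, k1, neg_smul]
  have hR : U * X * adjoint U - X = (-(2 * ε) : ℂ) • ((R * D) * star (R * D)) := by
    rw [h4, hXY, mul_smul_comm, smul_mul_assoc, smul_smul, ← hDD, star_mul,
      ContinuousLinearMap.star_eq_adjoint, ContinuousLinearMap.star_eq_adjoint, hDa]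
    simp only [mul_assoc]
    congr 1
    linear_combination (2 * (ε : ℂ)) * Complex.I_sq
  have hU := norm_le_one_of_unitary h2
  have hU' : ‖adjoint U‖ ≤ 1 := norm_le_one_of_unitary (by
    rw [ContinuousLinearMap.adjoint_adjoint]; exact h1)
  have hn : ‖U * X * adjoint U - X‖ ≤ 2 * ‖X‖ := by
    refine (norm_sub_le _ _).trans ?_
    have : ‖U * X * adjoint U‖ ≤ 1 * ‖X‖ * 1 := by
      refine (norm_mul_le _ _).trans (mul_le_mul ((norm_mul_le _ _).trans ?_) hU' (norm_nonneg _)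
        (by positivity))
      exact mul_le_mul_of_nonneg_right hU (norm_nonneg _)
    linarith
  rw [hR, norm_smul, CStarRing.norm_self_mul_star] at hn
  have h5 : ‖(-(2 * ε) : ℂ)‖ = 2 * ε := by
    rw [norm_neg, norm_mul, Complex.norm_real, Real.norm_of_nonneg hε.le]; simp
  rw [h5] at hn
  rw [quad_apply, ← h3, _root_.smul_apply, inner_smul_right, mul_apply_eq_comp,
    ContinuousLinearMap.adjoint_inner_right, Complex.re_ofReal_mul]
  have h6 : (⟪R (D v), R (D v)⟫_ℂ).re = ‖R (D v)‖ ^ 2 := inner_self_eq_norm_sq (𝕜 := ℂ) _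
  have h7 : ‖R (D v)‖ ≤ ‖R * D‖ := by
    have := (R * D).le_opNorm v
    rwa [hv, mul_one] at this
  rw [h6]
  have h8 : ‖R (D v)‖ ^ 2 ≤ ‖R * D‖ * ‖R * D‖ := by
    rw [← sq]; exact pow_le_pow_left₀ (norm_nonneg _) h7 2
  nlinarith

lemma kato (hA : AssumptionA e X Y D2 a b) (hD : TC e D2) {δ : ℝ} (hδ : 0 < δ) :
    ∃ c : ℝ, 0 ≤ c ∧ ∀ f : ℝ → ℝ, Continuous f → HasCompactSupport f → (∀ x, 0 ≤ f x) →
      (∀ x, f x ≤ 1) → nu hD (fc (fun x => (f x : ℂ)) Y) ≤ c * (∫ t, f t) + δ := by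
  obtain ⟨k1, k2, k3⟩ := fac hA
  obtain ⟨D, hD0, hDa, hDD⟩ := exists_sqrt k2
  have hhs : hs e D ≠ ∞ := by
    rw [hs_sqrt e hDa hDD]
    have := nuc_eq_tsum e D2
    rw [absOp_of_nonneg k2] at this
    rw [← this]
    exact hD
  have hsm : Summable fun i => ‖D (e i)‖ ^ 2 := by
    have := ENNReal.summable_toReal hhs
    simpa using this
  obtain ⟨s, htail⟩ := ((tendsto_order.1 (tendsto_tsum_compl_atTop_zero
    (fun i => ‖D (e i)‖ ^ 2))).2 _ hδ).exists
  refine ⟨s.card * (‖X‖ / Real.pi), by positivity, fun f hf hc h0 h1 => ?_⟩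
  set Z := fc (fun x => (f x : ℂ)) Y with hZ
  have hInt : 0 ≤ ∫ t, f t := integral_nonneg h0
  have hb1 : ∀ i, quad (D (e i)) Z ≤ ‖X‖ / Real.pi * ∫ t, f t := fun i =>
    poisson hA.hY hA.hspecY (quad (D (e i))) ‖X‖
      (fun ε hε t => kato_pk hA hDa hDD (e i) (e.orthonormal.1 i) hε t) hf hc h0
  have hZn : ‖Z‖ ≤ 1 := fc_norm_le hA.hY hA.hspecY zero_le_one fun x _ => by
    rw [Complex.norm_real, Real.norm_of_nonneg (h0 x)]; exact h1 x
  have hbn : ∀ i, ‖⟪D (e i), Z (D (e i))⟫_ℂ‖ ≤ ‖D (e i)‖ ^ 2 := fun i => by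
    refine (norm_inner_le_norm _ _).trans ?_
    have := (Z.le_opNorm (D (e i))).trans (mul_le_mul_of_nonneg_right hZn (norm_nonneg _))
    nlinarith [norm_nonneg (D (e i))]
  have hsum : Summable fun i => ⟪D (e i), Z (D (e i))⟫_ℂ := Summable.of_norm_bounded hsm hbn
  have hqs : Summable fun i => quad (D (e i)) Z := Complex.hasSum_re hsum.hasSum |>.summable
  have htr : trace e (Z * D2) = ∑' i, ⟪D (e i), Z (D (e i))⟫_ℂ := by
    have hZD : hs e (Z * D) ≠ ∞ :=
      ne_top_of_le_ne_top (ENNReal.mul_ne_top (ENNReal.pow_ne_top enorm_ne_top) hhs) (hs_mul_left e Z D)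
    have := hs_swap hhs hZD
    simp only [mul_apply_eq_comp] at this
    rw [this]
    unfold trace
    refine tsum_congr fun j => ?_
    rw [hDa, ContinuousLinearMap.adjoint_inner_left, ← hDD]
    rfl
  have hnu : nu hD Z = ∑' i, quad (D (e i)) Z := by
    have : nu hD Z = (trace e (Z * D2)).re := rfl
    rw [this, htr, Complex.re_tsum hsum]
    rfl
  rw [hnu, ← hqs.sum_add_tsum_subtype_compl s]
  refine add_le_add ?_ (le_trans ?_ htail.le)
  · refine (Finset.sum_le_sum fun i _ => hb1 i).trans ?_
    rw [Finset.sum_const, nsmul_eq_mul, mul_assoc]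
  · refine Summable.tsum_le_tsum (fun i => ?_) (hqs.subtype _) (hsm.subtype _)
    exact (Complex.re_le_norm _).trans (hbn i)
end kato

/-! ### Representation of positive functionals by densities -/
section reprs
open scoped CompactlySupported
variable {ι : Type*} {e : HilbertBasis ι ℂ H} {A X Y D2 : H →L[ℂ] H} {a b : ℝ}

lemma riesz_open_le (Q : C_c(ℝ, ℝ) →ₚ[ℝ] ℝ) {U : Set ℝ} (hU : IsOpen U) {M : ℝ}
    (h : ∀ f : C_c(ℝ, ℝ), (∀ x, 0 ≤ f x) → (∀ x, f x ≤ 1) → tsupport f ⊆ U → Q f ≤ M) :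
    RealRMK.rieszMeasure Q U ≤ ENNReal.ofReal M := by
  rw [hU.measure_eq_iSup_isCompact]
  refine iSup₂_le fun K hKU => iSup_le fun hK => ?_
  obtain ⟨f, h1, h2, h3, h4⟩ := exists_continuousMap_one_of_isCompact_subset_isOpen hK hU hKU
  refine (RealRMK.rieszMeasure_le_of_eq_one Q (f := ⟨f, h2⟩) (fun x => (h4 x).1) hK
    (fun x hx => h1 hx)).trans (ENNReal.ofReal_le_ofReal ?_)
  exact h _ (fun x => (h4 x).1) (fun x => (h4 x).2) h3

lemma riesz_repr (Q : C_c(ℝ, ℝ) →ₚ[ℝ] ℝ)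
    (hac : ∀ δ : ℝ, 0 < δ → ∃ c : ℝ, 0 ≤ c ∧ ∀ f : C_c(ℝ, ℝ), (∀ x, 0 ≤ f x) → (∀ x, f x ≤ 1) →
      Q f ≤ c * (∫ x, f x) + δ)
    (hsupp : ∀ f : C_c(ℝ, ℝ), (∀ x ∈ Set.Icc a b, f x = 0) → Q f = 0) :
    ∃ ρ : ℝ → ℝ, (∀ x, 0 ≤ ρ x) ∧ IntegrableOn ρ (Set.Icc a b) ∧
      ∀ f : C_c(ℝ, ℝ), Q f = ∫ x in Set.Icc a b, f x * ρ x := by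
  set μ := RealRMK.rieszMeasure Q with hμ
  have h0 : μ (Set.Icc a b)ᶜ = 0 := by
    have := riesz_open_le Q (U := (Set.Icc a b)ᶜ) isClosed_Icc.isOpen_compl (M := 0)
      fun f _ _ hf => (hsupp f fun x hx => by
        by_contra hne
        exact hf (subset_tsupport _ hne) hx).le
    simpa using this
  have hfin : IsFiniteMeasure μ := by
    constructor
    rw [← Set.union_compl_self (Set.Icc a b)]
    refine (measure_union_le _ _).trans_lt ?_
    rw [h0, add_zero]
    exact isCompact_Icc.measure_lt_top
  have hacμ : μ ≪ volume := by
    refine Measure.AbsolutelyContinuous.mk fun N _ hN => ?_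
    have key : ∀ δ : ℝ, 0 < δ → μ N ≤ ENNReal.ofReal (2 * δ) := by
      intro δ hδ
      obtain ⟨c, hc, hcf⟩ := hac δ hδ
      obtain ⟨U, hNU, hUo, hUv⟩ := Set.exists_isOpen_lt_of_lt N (ENNReal.ofReal (δ / (c + 1)))
        (by rw [hN]; exact ENNReal.ofReal_pos.2 (by positivity))
      refine (measure_mono hNU).trans (riesz_open_le Q hUo fun f f0 f1 fU => ?_)
      have hUfin : volume U ≠ ∞ := (hUv.trans ENNReal.ofReal_lt_top).ne
      have hi : ∫ x, f x ≤ δ / (c + 1) := by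
        have e1 : ∫ x, f x = ∫ x in U, f x := by
          rw [setIntegral_eq_integral_of_forall_compl_eq_zero]
          intro x hx
          by_contra hne
          exact hx (fU (subset_tsupport _ hne))
        rw [e1]
        have e2 : ∫ x in U, f x ≤ ∫ x in U, (1:ℝ) := by
          refine setIntegral_mono_on ?_ ?_ hUo.measurableSet fun x _ => f1 x
          · exact (f.continuous.integrable_of_hasCompactSupport f.hasCompactSupport).integrableOn
          · exact integrableOn_const hUfin
        refine e2.trans ?_
        rw [setIntegral_const, smul_eq_mul, mul_one, Measure.real]
        exact ENNReal.toReal_le_of_le_ofReal (by positivity) hUv.le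
      have := hcf f f0 f1
      have h3 : c * (δ / (c + 1)) ≤ δ := by
        rw [mul_div_assoc', div_le_iff₀ (by positivity)]; nlinarith
      nlinarith [mul_le_mul_of_nonneg_left hi hc]
    refine le_antisymm (ENNReal.le_of_forall_pos_le_add fun δ hδ _ => ?_) bot_le
    have := key (δ / 2) (by positivity)
    rw [zero_add]
    convert this using 1
    rw [mul_div_cancel₀ _ (two_ne_zero), ENNReal.ofReal_coe_nnreal]
  refine ⟨fun x => (μ.rnDeriv volume x).toReal, fun x => ENNReal.toReal_nonneg,
    (Measure.integrable_toReal_rnDeriv).integrableOn, fun f => ?_⟩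
  rw [← RealRMK.integral_rieszMeasure Q f, ← hμ]
  have e1 : μ.restrict (Set.Icc a b) = μ := by
    refine Measure.restrict_eq_self_of_ae_mem ?_
    exact h0
  conv_lhs => rw [← e1]
  rw [← setIntegral_rnDeriv_smul hacμ measurableSet_Icc]
  simp only [smul_eq_mul, mul_comm]

lemma op_repr (hA : AssumptionA e X Y D2 a b) (hD : TC e D2) (L : (H →L[ℂ] H) →L[ℝ] ℝ) {k : ℝ}
    (hk : 0 < k) (hL : ∀ f : ℝ → ℝ, ContinuousOn f (Set.Icc a b) → (∀ x ∈ Set.Icc a b, 0 ≤ f x) →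
      0 ≤ L (fc (fun x => (f x : ℂ)) Y) ∧
        L (fc (fun x => (f x : ℂ)) Y) ≤ k * nu hD (fc (fun x => (f x : ℂ)) Y)) :
    ∃ ρ : ℝ → ℝ, (∀ x, 0 ≤ ρ x) ∧ IntegrableOn ρ (Set.Icc a b) ∧
      ∀ f : ℝ → ℝ, ContinuousOn f (Set.Icc a b) →
        L (fc (fun x => (f x : ℂ)) Y) = ∫ x in Set.Icc a b, f x * ρ x := by
  have oc : ∀ f : ℝ → ℝ, ContinuousOn f (Set.Icc a b) →
      ContinuousOn (fun x => (f x : ℂ)) (Set.Icc a b) := fun f hf =>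
    Complex.continuous_ofReal.comp_continuousOn hf
  let Q0 : C_c(ℝ, ℝ) →ₗ[ℝ] ℝ :=
    { toFun := fun f => L (fc (fun x => (f x : ℂ)) Y)
      map_add' := fun f g => by
        rw [← map_add, ← fc_add hA.hY hA.hspecY (oc (fun x => f x) f.continuous.continuousOn)
          (oc (fun x => g x) g.continuous.continuousOn)]
        simp
      map_smul' := fun c f => by
        rw [RingHom.id_apply, ← map_smul, ← Complex.coe_smul, ← fc_const_mul hA.hY hA.hspecY _
          (oc (fun x => f x) f.continuous.continuousOn)]
        simp }
  let Q : C_c(ℝ, ℝ) →ₚ[ℝ] ℝ := PositiveLinearMap.mk₀ Q0 fun f hf =>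
    (hL f f.continuous.continuousOn fun x _ => hf x).1
  have hQ : ∀ f, Q f = L (fc (fun x => (f x : ℂ)) Y) := fun f => rfl
  obtain ⟨ρ, r1, r2, r3⟩ := riesz_repr (a := a) (b := b) Q (fun δ hδ => by
    obtain ⟨c, hc, hcf⟩ := kato hA hD (δ := δ / k) (by positivity)
    refine ⟨k * c, by positivity, fun f f0 f1 => ?_⟩
    have h1 := (hL f f.continuous.continuousOn fun x _ => f0 x).2
    have h2 := hcf f f.continuous f.hasCompactSupport f0 f1
    rw [hQ]
    have h3 := h1.trans (mul_le_mul_of_nonneg_left h2 hk.le)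
    have h4 : k * (δ / k) = δ := by field_simp
    rw [mul_add, h4, ← mul_assoc] at h3
    exact h3) fun f hf => by
    rw [hQ, fc_congr hA.hY hA.hspecY (g := fun _ => 0), fc_const hA.hY, zero_smul, map_zero]
    intro x hx
    simp only [hf x hx, Complex.ofReal_zero]
  refine ⟨ρ, r1, r2, ?_⟩
  have hnn : ∀ f : ℝ → ℝ, ContinuousOn f (Set.Icc a b) → (∀ x ∈ Set.Icc a b, 0 ≤ f x) →
      L (fc (fun x => (f x : ℂ)) Y) = ∫ x in Set.Icc a b, f x * ρ x := by
    intro f hf f0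
    obtain ⟨F, h1, h2, h3, h4⟩ := ext_cc hA.hab hf f0
    have := r3 ⟨⟨F, h1⟩, h2⟩
    rw [hQ] at this
    rw [fc_congr hA.hY hA.hspecY (g := fun x => (F x : ℂ)) fun x hx => by simp only [h4 hx]]
    refine this.trans (setIntegral_congr_fun measurableSet_Icc fun x hx => ?_)
    show F x * ρ x = f x * ρ x
    rw [h4 hx]
  intro f hf
  have c1 : ContinuousOn (fun x => max (f x) 0) (Set.Icc a b) := hf.sup continuousOn_const
  have c2 : ContinuousOn (fun x => max (-f x) 0) (Set.Icc a b) := hf.neg.sup continuousOn_const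
  have e1 := hnn _ c1 fun x _ => le_max_right _ _
  have e2 := hnn _ c2 fun x _ => le_max_right _ _
  have e3 : ∀ x, f x = max (f x) 0 - max (-f x) 0 := fun x => by
    rcases le_total 0 (f x) with h | h
    · rw [max_eq_left h, max_eq_right (by linarith), sub_zero]
    · rw [max_eq_right h, max_eq_left (by linarith)]; ring
  have e4 : fc (fun x => (f x : ℂ)) Y = fc (fun x => ((max (f x) 0 : ℝ) : ℂ)) Y -
      fc (fun x => ((max (-f x) 0 : ℝ) : ℂ)) Y := by
    rw [← fc_sub hA.hY hA.hspecY (oc _ c1) (oc _ c2)]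
    congr 1
    funext x
    rw [← Complex.ofReal_sub, ← e3]
  rw [e4, map_sub, e1, e2, ← integral_sub]
  · refine integral_congr_ae (Filter.Eventually.of_forall fun x => ?_)
    show _ - _ = f x * ρ x
    rw [← sub_mul, ← e3]
  · exact r2.continuousOn_mul c1 isCompact_Icc
  · exact r2.continuousOn_mul c2 isCompact_Icc
end reprs

/-! ### Existence of the density -/
section existence
variable {ι : Type*} {e : HilbertBasis ι ℂ H} {X Y D2 : H →L[ℂ] H} {a b : ℝ}

lemma exists_eta (hA : AssumptionA e X Y D2 a b) {P : (ℝ → ℂ) → Prop}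
    (hP : P = MemC11 ∨ P = IsPolyFun) {φ : ℝ → ℂ} (hφ : P φ)
    (hK : TC e (Y * fc φ X - fc φ X * Y)) :
    ∃ η : ℝ → ℂ, IntegrableOn η (Set.Icc a b) ∧
      ∀ f : ℝ → ℂ, ContinuousOn f (Set.Icc a b) →
        Lam hK (fc f Y) = ∫ x in Set.Icc a b, f x * η x := by
  have hdc : Continuous (deriv φ) := (P_contDiff hP hφ).2
  obtain ⟨-, hD0, hD⟩ := fac hA
  obtain ⟨m0, hm0⟩ := isCompact_Icc.exists_bound_of_continuousOn (s := Set.Icc a b) hdc.continuousOn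
  set m : ℝ := |m0| + 1 with hmdef
  have hmp : 0 < m := by positivity
  have hm : ∀ x ∈ Set.Icc a b, ‖deriv φ x‖ ≤ m := fun x hx =>
    (hm0 x hx).trans ((le_abs_self _).trans (by linarith))
  obtain ⟨ρ0, -, i0, r0⟩ := op_repr hA hD (nu hD) one_pos fun f hf h0 =>
    ⟨nu_pos hA.hY hA.hspecY hD0 hD h0, by rw [one_mul]⟩
  obtain ⟨ρ1, -, i1, r1⟩ := op_repr hA hD (LamRe hK + m • nu hD) (k := 2 * m) (by positivity)
    fun f hf h0 => by
      have := abs_le.1 (main_pos hA hP hφ hK hD hm hf h0).1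
      simp only [_root_.add_apply, _root_.smul_apply, smul_eq_mul]
      constructor <;> linarith [this.1, this.2]
  obtain ⟨ρ2, -, i2, r2⟩ := op_repr hA hD (LamIm hK + m • nu hD) (k := 2 * m) (by positivity)
    fun f hf h0 => by
      have := abs_le.1 (main_pos hA hP hφ hK hD hm hf h0).2.1
      simp only [_root_.add_apply, _root_.smul_apply, smul_eq_mul]
      constructor <;> linarith [this.1, this.2]
  have j1 : IntegrableOn (fun x => ρ1 x - m * ρ0 x) (Set.Icc a b) := i1.sub (i0.const_mul m)
  have j2 : IntegrableOn (fun x => ρ2 x - m * ρ0 x) (Set.Icc a b) := i2.sub (i0.const_mul m)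
  have k1 : IntegrableOn (fun x => ((ρ1 x - m * ρ0 x : ℝ) : ℂ)) (Set.Icc a b) := j1.ofReal
  have k2 : IntegrableOn (fun x => ((ρ2 x - m * ρ0 x : ℝ) : ℂ)) (Set.Icc a b) := j2.ofReal
  have hη : IntegrableOn (fun x => ((ρ1 x - m * ρ0 x : ℝ) : ℂ) +
    Complex.I * ((ρ2 x - m * ρ0 x : ℝ) : ℂ)) (Set.Icc a b) := k1.add (k2.const_mul _)
  refine ⟨_, hη, ?_⟩
  have hre : ∀ f : ℝ → ℝ, ContinuousOn f (Set.Icc a b) → Lam hK (fc (fun x => (f x : ℂ)) Y) =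
      ∫ x in Set.Icc a b, (f x : ℂ) * (((ρ1 x - m * ρ0 x : ℝ) : ℂ) +
        Complex.I * ((ρ2 x - m * ρ0 x : ℝ) : ℂ)) := by
    intro f hf
    have a0 := r0 f hf
    have a1 := r1 f hf
    have a2 := r2 f hf
    simp only [_root_.add_apply, _root_.smul_apply, smul_eq_mul] at a1 a2
    have g0 := i0.continuousOn_mul hf isCompact_Icc
    have g1 := i1.continuousOn_mul hf isCompact_Icc
    have g2 := i2.continuousOn_mul hf isCompact_Icc
    have b1 : LamRe hK (fc (fun x => (f x : ℂ)) Y) =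
        ∫ x in Set.Icc a b, f x * (ρ1 x - m * ρ0 x) := by
      have : ∀ x, f x * (ρ1 x - m * ρ0 x) = f x * ρ1 x - m * (f x * ρ0 x) := fun x => by ring
      simp only [this]
      rw [integral_sub g1 (g0.const_mul m), integral_const_mul]
      first
        | exact eq_sub_of_add_eq (by rw [← a1, ← a0])
        | exact eq_sub_of_add_eq (by rw [← a2, ← a0])
    have b2 : LamIm hK (fc (fun x => (f x : ℂ)) Y) =
        ∫ x in Set.Icc a b, f x * (ρ2 x - m * ρ0 x) := by
      have : ∀ x, f x * (ρ2 x - m * ρ0 x) = f x * ρ2 x - m * (f x * ρ0 x) := fun x => by ring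
      simp only [this]
      rw [integral_sub g2 (g0.const_mul m), integral_const_mul]
      first
        | exact eq_sub_of_add_eq (by rw [← a1, ← a0])
        | exact eq_sub_of_add_eq (by rw [← a2, ← a0])
    have d1 : Lam hK (fc (fun x => (f x : ℂ)) Y) = (LamRe hK (fc (fun x => (f x : ℂ)) Y) : ℂ) +
      Complex.I * (LamIm hK (fc (fun x => (f x : ℂ)) Y) : ℂ) := by
      rw [mul_comm]; exact (Complex.re_add_im _).symm
    rw [d1, b1, b2, ← integral_complex_ofReal, ← integral_complex_ofReal, ← integral_const_mul,
      ← integral_add]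
    · refine integral_congr_ae (Filter.Eventually.of_forall fun x => ?_)
      simp only []
      push_cast
      ring
    · exact (j1.continuousOn_mul hf isCompact_Icc).ofReal
    · exact (Integrable.ofReal (j2.continuousOn_mul hf isCompact_Icc)).const_mul _
  intro f hf
  have c1 : ContinuousOn (fun x => (f x).re) (Set.Icc a b) :=
    Complex.continuous_re.comp_continuousOn hf
  have c2 : ContinuousOn (fun x => (f x).im) (Set.Icc a b) :=
    Complex.continuous_im.comp_continuousOn hf
  have c1' : ContinuousOn (fun x => ((f x).re : ℂ)) (Set.Icc a b) :=
    Complex.continuous_ofReal.comp_continuousOn c1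
  have c2' : ContinuousOn (fun x => ((f x).im : ℂ)) (Set.Icc a b) :=
    Complex.continuous_ofReal.comp_continuousOn c2
  have hsp : fc f Y = fc (fun x => ((f x).re : ℂ)) Y +
      Complex.I • fc (fun x => ((f x).im : ℂ)) Y := by
    rw [← fc_const_mul hA.hY hA.hspecY _ c2', ← fc_add hA.hY hA.hspecY c1'
      (g := fun x => Complex.I * ((f x).im : ℂ)) (continuousOn_const.mul c2')]
    congr 1
    funext x
    rw [mul_comm, Complex.re_add_im]
  rw [hsp, map_add, map_smul, hre _ c1, hre _ c2, smul_eq_mul, ← integral_const_mul,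
    ← integral_add]
  · refine integral_congr_ae (Filter.Eventually.of_forall fun x => ?_)
    show _ + _ = _
    rw [← mul_assoc, ← add_mul, mul_comm Complex.I, Complex.re_add_im]
  · exact hη.continuousOn_mul c1' isCompact_Icc
  · exact Integrable.const_mul (hη.continuousOn_mul c2' isCompact_Icc) _

lemma Lam_norm_le {K : H →L[ℂ] H} (hK : TC e K) (Z : H →L[ℂ] H) :
    ‖Lam hK Z‖ ≤ ‖Z‖ * traceNorm e ((-Complex.I) • K) := by
  have h1 : TC e ((-Complex.I) • K) := hK.smul _
  have h0 : 0 ≤ traceNorm e ((-Complex.I) • K) ∨ traceNorm e ((-Complex.I) • K) ≤ 0 :=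
    le_total _ _
  have h2 := nuc_eq_traceNorm e _ h1
  have h3 : Lam hK Z = trace e (Z * ((-Complex.I) • K)) := by
    rw [Lam_apply, mul_smul_comm, trace_smul]
  have hn : 0 ≤ traceNorm e ((-Complex.I) • K) := by
    refine tsum_nonneg fun i => ?_
    refine inner_nonneg_re ?_ _
    exact cfc_nonneg fun x _ => Real.sqrt_nonneg x
  rw [h3]
  refine (norm_trace_le (h1.mul_left _)).trans ?_
  have h4 := nuc_mul_left e Z ((-Complex.I) • K)
  have h5 := ENNReal.toReal_mono (ENNReal.mul_ne_top enorm_ne_top h1) h4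
  rw [ENNReal.toReal_mul, h2, ENNReal.toReal_ofReal hn, toReal_enorm] at h5
  exact h5

end existence

section measure
variable {a b : ℝ}

/-- The `L¹` norm is determined by continuous test functions. -/
lemma l1_le {η : ℝ → ℂ} (hη : IntegrableOn η (Set.Icc a b)) {C : ℝ}
    (h : ∀ f : ℝ → ℂ, Continuous f → (∀ x, ‖f x‖ ≤ 1) → ‖∫ x in Set.Icc a b, f x * η x‖ ≤ C) :
    (∫ x in Set.Icc a b, ‖η x‖) ≤ C := by
  refine le_of_forall_pos_le_add fun ε hε => ?_
  set V : ℝ := (volume (Set.Icc a b)).toReal with hV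
  have hV0 : 0 ≤ V := ENNReal.toReal_nonneg
  obtain ⟨g, gs, gε, gc, gi⟩ := hη.exists_hasCompactSupport_integral_sub_le (ε := ε / 4)
    (by positivity)
  set δ : ℝ := ε / (2 * (V + 1)) with hδ
  have hδ0 : 0 < δ := by positivity
  set f : ℝ → ℂ := fun x => (starRingEnd ℂ) (g x) * ((‖g x‖ + δ : ℝ) : ℂ)⁻¹ with hf
  have hne : ∀ x, ((‖g x‖ + δ : ℝ) : ℂ) ≠ 0 := fun x => by
    rw [Ne, Complex.ofReal_eq_zero]; positivity
  have hfc : Continuous f := by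
    refine (Complex.continuous_conj.comp gc).mul (Continuous.inv₀ ?_ hne)
    exact Complex.continuous_ofReal.comp (gc.norm.add continuous_const)
  have hf1 : ∀ x, ‖f x‖ ≤ 1 := fun x => by
    have : 0 < ‖g x‖ + δ := by positivity
    rw [hf]
    simp only [norm_mul, norm_inv, RCLike.norm_conj, Complex.norm_real, Real.norm_eq_abs,
      abs_of_pos this]
    rw [← div_eq_mul_inv, div_le_one this]; linarith
  have h1 := h f hfc hf1
  have ifη : IntegrableOn (fun x => f x * η x) (Set.Icc a b) :=
    hη.continuousOn_mul hfc.continuousOn isCompact_Icc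
  have hpt : ∀ x, ‖η x‖ ≤ (f x * η x).re + 2 * ‖η x - g x‖ + δ := fun x => by
    have p : 0 < ‖g x‖ + δ := by positivity
    have e1 : f x * g x = ((‖g x‖ ^ 2 / (‖g x‖ + δ) : ℝ) : ℂ) := by
      rw [hf]
      simp only []
      rw [mul_right_comm, Complex.conj_mul']
      push_cast
      rw [div_eq_mul_inv]
    have e2 : ‖g x‖ - δ ≤ ‖g x‖ ^ 2 / (‖g x‖ + δ) := by
      rw [le_div_iff₀ p]; nlinarith [sq_nonneg δ]
    have e3 : (f x * η x).re = ‖g x‖ ^ 2 / (‖g x‖ + δ) + (f x * (η x - g x)).re := by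
      rw [mul_sub, Complex.sub_re, e1, Complex.ofReal_re]; ring
    have e4 : -‖η x - g x‖ ≤ (f x * (η x - g x)).re := by
      have := (abs_le.1 (Complex.abs_re_le_norm (f x * (η x - g x)))).1
      rw [norm_mul] at this
      have := mul_le_of_le_one_left (norm_nonneg (η x - g x)) (hf1 x)
      linarith
    have e5 : ‖η x‖ ≤ ‖g x‖ + ‖η x - g x‖ := by
      have := norm_add_le (g x) (η x - g x)
      rwa [add_sub_cancel] at this
    linarith
  have ire : IntegrableOn (fun x => (f x * η x).re) (Set.Icc a b) := ifη.re
  have isub : IntegrableOn (fun x => 2 * ‖η x - g x‖) (Set.Icc a b) :=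
    Integrable.const_mul (Integrable.norm (Integrable.sub hη gi)) 2
  have ic : IntegrableOn (fun _ : ℝ => δ) (Set.Icc a b) := integrableOn_const (by simp)
  have h2 : (∫ x in Set.Icc a b, ‖η x‖) ≤
      ∫ x in Set.Icc a b, ((f x * η x).re + 2 * ‖η x - g x‖ + δ) :=
    integral_mono hη.norm ((ire.add isub).add ic) hpt
  have iadd : IntegrableOn (fun x => (f x * η x).re + 2 * ‖η x - g x‖) (Set.Icc a b) :=
    ire.add isub
  rw [integral_add iadd ic, integral_add ire isub, integral_const_mul,
    setIntegral_const, smul_eq_mul] at h2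
  have h3 : (∫ x in Set.Icc a b, (f x * η x).re) ≤ C := by
    have : (∫ x in Set.Icc a b, (f x * η x).re) = (∫ x in Set.Icc a b, f x * η x).re :=
      integral_re ifη
    rw [this]
    exact (Complex.re_le_norm _).trans h1
  have h4 : V * δ ≤ ε / 2 := by
    rw [hδ, mul_div_assoc', div_le_iff₀ (by positivity)]; nlinarith
  have h5 : volume.real (Set.Icc a b) = V := rfl
  rw [h5] at h2
  linarith

/-- A density that annihilates all continuous functions vanishes. -/
lemma zero_of_cont {h : ℝ → ℂ} (hh : IntegrableOn h (Set.Icc a b))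
    (hz : ∀ f : ℝ → ℂ, Continuous f → ∫ x in Set.Icc a b, f x * h x = 0) :
    ∀ᵐ x ∂(volume : Measure ℝ), x ∈ Set.Icc a b → h x = 0 := by
  have h1 := l1_le hh (C := 0) fun f hf _ => by rw [hz f hf, norm_zero]
  have h2 : (∫ x in Set.Icc a b, ‖h x‖) = 0 :=
    le_antisymm h1 (integral_nonneg fun _ => norm_nonneg _)
  rw [integral_eq_zero_iff_of_nonneg (fun _ => norm_nonneg _) hh.norm] at h2
  rw [← ae_restrict_iff' measurableSet_Icc]
  filter_upwards [h2] with x hx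
  simpa using hx

/-- A density that annihilates all polynomials vanishes. -/
lemma zero_of_poly {h : ℝ → ℂ} (hh : IntegrableOn h (Set.Icc a b))
    (hz : ∀ p : ℝ[X], ∫ x in Set.Icc a b, ((p.eval x : ℝ) : ℂ) * h x = 0) :
    ∀ᵐ x ∂(volume : Measure ℝ), x ∈ Set.Icc a b → h x = 0 := by
  have hre : ∀ f : ℝ → ℝ, Continuous f → ∫ x in Set.Icc a b, ((f x : ℝ) : ℂ) * h x = 0 := by
    intro f hf
    rw [← norm_le_zero_iff]
    refine le_of_forall_pos_le_add fun ε hε => ?_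
    set M : ℝ := ∫ x in Set.Icc a b, ‖h x‖ with hM
    have hM0 : 0 ≤ M := integral_nonneg fun _ => norm_nonneg _
    obtain ⟨p, hp⟩ := exists_polynomial_near_of_continuousOn a b f hf.continuousOn (ε / (M + 1))
      (by positivity)
    have i1 : IntegrableOn (fun x => ((f x : ℝ) : ℂ) * h x) (Set.Icc a b) :=
      hh.continuousOn_mul (Complex.continuous_ofReal.comp hf).continuousOn isCompact_Icc
    have i2 : IntegrableOn (fun x => ((p.eval x : ℝ) : ℂ) * h x) (Set.Icc a b) :=
      hh.continuousOn_mul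
        (Complex.continuous_ofReal.comp p.continuous).continuousOn isCompact_Icc
    have e1 : ∫ x in Set.Icc a b, ((f x : ℝ) : ℂ) * h x =
        ∫ x in Set.Icc a b, (((f x : ℝ) : ℂ) * h x - ((p.eval x : ℝ) : ℂ) * h x) := by
      rw [integral_sub i1 i2, hz p, sub_zero]
    rw [e1, zero_add]
    have e2 : ‖∫ x in Set.Icc a b, (((f x : ℝ) : ℂ) * h x - ((p.eval x : ℝ) : ℂ) * h x)‖ ≤
        ∫ x in Set.Icc a b, ε / (M + 1) * ‖h x‖ := by
      refine norm_integral_le_of_norm_le (Integrable.const_mul hh.norm _) ?_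
      rw [ae_restrict_iff' measurableSet_Icc]
      refine Filter.Eventually.of_forall fun x hx => ?_
      rw [← sub_mul, norm_mul, ← Complex.ofReal_sub, Complex.norm_real, Real.norm_eq_abs, abs_sub_comm]
      exact mul_le_mul_of_nonneg_right (hp x hx).le (norm_nonneg _)
    refine e2.trans ?_
    rw [integral_const_mul, ← hM, div_mul_eq_mul_div, div_le_iff₀ (by positivity)]
    nlinarith
  refine zero_of_cont hh fun f hf => ?_
  have c1 : Continuous fun x => (f x).re := Complex.continuous_re.comp hf
  have c2 : Continuous fun x => (f x).im := Complex.continuous_im.comp hf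
  have : ∀ x, f x * h x = ((f x).re : ℂ) * h x + Complex.I * (((f x).im : ℂ) * h x) := fun x => by
    rw [← mul_assoc, ← add_mul, mul_comm Complex.I, Complex.re_add_im]
  simp only [this]
  rw [integral_add, integral_const_mul, hre _ c1, hre _ c2, mul_zero, add_zero]
  · exact hh.continuousOn_mul (Complex.continuous_ofReal.comp c1).continuousOn
      isCompact_Icc
  · exact Integrable.const_mul (hh.continuousOn_mul
      (Complex.continuous_ofReal.comp c2).continuousOn isCompact_Icc) _

/-- Smooth compactly supported functions are in `C¹₁`. -/
lemma memC11_of_smooth {ψ : ℝ → ℂ} (h1 : ContDiff ℝ (⊤ : ℕ∞) ψ) (h2 : HasCompactSupport ψ) :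
    MemC11 ψ := by
  set f : SchwartzMap ℝ ℂ := h2.toSchwartzMap h1 with hf
  have hfx : ∀ x, f x = ψ x := fun x => rfl
  set F : SchwartzMap ℝ ℂ := FourierTransform.fourier f with hF
  have hpi : (2 * Real.pi) ≠ 0 := by positivity
  set c : ℝ := Real.sqrt (2 * Real.pi) * (2 * Real.pi)⁻¹ with hc
  have i1 : Integrable (fun α : ℝ => F (α / (2 * Real.pi))) := F.integrable.comp_div hpi
  have i2 : Integrable (fun w : ℝ => w • F w) := by
    refine ((F.integrable_pow_mul volume 1).mono' ?_ ?_)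
    · exact (continuous_id.smul F.continuous).aestronglyMeasurable
    · exact Filter.Eventually.of_forall fun x => by rw [norm_smul, pow_one]
  have i3 := i2.comp_div hpi
  refine ⟨fun α => c • F (α / (2 * Real.pi)), i1.smul c, ?_, fun β => ?_⟩
  · have := i3.smul (c * (2 * Real.pi))
    refine this.congr (Filter.Eventually.of_forall fun α => ?_)
    simp only [smul_smul, Pi.smul_apply]
    congr 1
    field_simp
  · have h3 : FourierTransformInv.fourierInv F β = ψ β := by
      rw [hF, FourierTransform.fourierInv_fourier_eq]
      rfl
    rw [← h3, SchwartzMap.fourierInv_coe, Real.fourierInv_eq']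
    have h4 : (∫ v : ℝ, Complex.exp (((2 * Real.pi * inner ℝ v β : ℝ) : ℂ) * Complex.I) • F v) =
        (2 * Real.pi)⁻¹ • ∫ α : ℝ, Complex.exp (Complex.I * α * β) • F (α / (2 * Real.pi)) := by
      have := Measure.integral_comp_div
        (fun v : ℝ => Complex.exp (((2 * Real.pi * inner ℝ v β : ℝ) : ℂ) * Complex.I) • F v)
        (2 * Real.pi)
      rw [abs_of_pos (by positivity)] at this
      rw [eq_inv_smul_iff₀ hpi, ← this]
      refine integral_congr_ae (Filter.Eventually.of_forall fun α => ?_)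
      simp only []
      congr 2
      have e1 : 2 * Real.pi * inner ℝ (α / (2 * Real.pi)) β = α * β := by
        simp only [RCLike.inner_apply, conj_trivial]
        field_simp
      rw [e1]
      push_cast
      ring
    rw [h4]
    simp only [smul_comm _ c]
    rw [integral_smul, smul_smul, hc, ← mul_assoc, inv_mul_cancel₀ (by positivity), one_mul]

/-- Every real polynomial is on `[a,b]` the derivative of a function of the class `P`. -/
lemma exists_primitive (a b : ℝ) {P : (ℝ → ℂ) → Prop} (hP : P = MemC11 ∨ P = IsPolyFun) (p : ℝ[X]) :
    ∃ ψ, P ψ ∧ ∀ x ∈ Set.Icc a b, deriv ψ x = ((p.eval x : ℝ) : ℂ) := by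
  obtain ⟨q, rfl⟩ := exists_antideriv p
  have hd : ∀ x, HasDerivAt (fun t : ℝ => ((q.eval t : ℝ) : ℂ))
      (((derivative q).eval x : ℝ) : ℂ) x := fun x => (q.hasDerivAt x).ofReal_comp
  rcases hP with rfl | rfl
  · let χ : ContDiffBump (0 : ℝ) := ⟨|a| + |b| + 1, |a| + |b| + 2, by positivity, by linarith⟩
    have s1 : ContDiff ℝ (⊤ : ℕ∞) (fun t : ℝ => ((χ t : ℝ) : ℂ)) :=
      Complex.ofRealCLM.contDiff.comp χ.contDiff
    have s2 : ContDiff ℝ (⊤ : ℕ∞) (fun t : ℝ => ((q.eval t : ℝ) : ℂ)) :=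
      Complex.ofRealCLM.contDiff.comp (by simpa using q.contDiff_aeval (𝕜 := ℝ) (⊤ : ℕ∞))
    refine ⟨fun t => ((χ t : ℝ) : ℂ) * ((q.eval t : ℝ) : ℂ), memC11_of_smooth (s1.mul s2) ?_, ?_⟩
    · refine HasCompactSupport.mul_right ?_
      exact χ.hasCompactSupport.comp_left (g := fun x : ℝ => (x : ℂ)) Complex.ofReal_zero
    · intro x hx
      have hb : x ∈ Metric.ball (0 : ℝ) χ.rIn := by
        rw [mem_ball_zero_iff, Real.norm_eq_abs]
        show |x| < |a| + |b| + 1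
        rw [abs_lt]
        constructor <;> linarith [neg_abs_le a, le_abs_self b, hx.1, hx.2, abs_nonneg a, abs_nonneg b]
      have he := χ.eventuallyEq_one_of_mem_ball hb
      rw [← (hd x).deriv]
      refine Filter.EventuallyEq.deriv_eq ?_
      filter_upwards [he] with t ht
      rw [ht]; simp
  · refine ⟨fun t => ((q.eval t : ℝ) : ℂ), ⟨q.map (algebraMap ℝ ℂ), fun t => ?_⟩, fun x _ =>
      (hd x).deriv⟩
    rw [eval_map_real]
end measure

theorem statement10 {ι : Type*} (e : HilbertBasis ι ℂ H) (X Y D2 : H →L[ℂ] H)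
    (a b : ℝ) (hA : AssumptionA e X Y D2 a b)
    (P : (ℝ → ℂ) → Prop) (hP : P = MemC11 ∨ P = IsPolyFun)
    (φ : ℝ → ℂ) (hφ : P φ) :
    ∃ η : ℝ → ℂ, IntegrableOn η (Set.Icc a b) ∧
      (∀ ψ : ℝ → ℂ, P ψ →
        (-Complex.I) * trace e (fc ψ Y * fc φ X - fc φ X * fc ψ Y) =
          ∫ l in Set.Icc a b, deriv ψ l * η l) ∧
      (∫ l in Set.Icc a b, ‖η l‖) ≤
        traceNorm e ((-Complex.I) • (Y * fc φ X - fc φ X * Y)) ∧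
      (∫ l in Set.Icc a b, η l) = trace e (fc (deriv φ) X * D2) ∧
      ((∀ t ∈ Set.Icc a b, ∃ c : ℝ, 0 ≤ c ∧ deriv φ t = (c : ℂ)) →
        ∀ᵐ l ∂(volume : Measure ℝ), l ∈ Set.Icc a b → (η l).im = 0 ∧ 0 ≤ (η l).re) ∧
      ∀ η' : ℝ → ℂ, IntegrableOn η' (Set.Icc a b) →
        (∀ ψ : ℝ → ℂ, P ψ →
          (-Complex.I) * trace e (fc ψ Y * fc φ X - fc φ X * fc ψ Y) =
            ∫ l in Set.Icc a b, deriv ψ l * η' l) →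
        ∀ᵐ l ∂(volume : Measure ℝ), l ∈ Set.Icc a b → η' l = η l := by
  have hK := K0_TC hA hP hφ
  obtain ⟨-, hD0, hD⟩ := fac hA
  obtain ⟨η, hη, hL⟩ := exists_eta hA hP hφ hK
  have form : ∀ ψ : ℝ → ℂ, P ψ →
      (-Complex.I) * trace e (fc ψ Y * fc φ X - fc φ X * fc ψ Y) =
        ∫ l in Set.Icc a b, deriv ψ l * η l := fun ψ hψ => by
    rw [key_id hA hP hφ hP hψ, ← hL _ (P_contDiff hP hψ).2.continuousOn, Lam_apply]
  refine ⟨η, hη, form, ?_, ?_, ?_, ?_⟩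
  · refine l1_le hη fun f hf h1 => ?_
    rw [← hL f hf.continuousOn]
    refine (Lam_norm_le hK _).trans ?_
    have hn : 0 ≤ traceNorm e ((-Complex.I) • (Y * fc φ X - fc φ X * Y)) := by
      refine tsum_nonneg fun i => inner_nonneg_re ?_ _
      exact cfc_nonneg fun x _ => Real.sqrt_nonneg x
    exact mul_le_of_le_one_left hn (fc_norm_le hA.hY hA.hspecY zero_le_one fun x _ => h1 x)
  · rw [← K0_trace hA hP hφ]
    have := hL (fun _ => 1) continuousOn_const
    rw [fc_const hA.hY, one_smul, Lam_apply, one_mul] at this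
    rw [this]
    simp only [one_mul]
  · intro hpos
    obtain ⟨m0, hm0⟩ := isCompact_Icc.exists_bound_of_continuousOn (s := Set.Icc a b)
      (P_contDiff hP hφ).2.continuousOn
    have hm : ∀ x ∈ Set.Icc a b, ‖deriv φ x‖ ≤ |m0| + 1 := fun x hx =>
      (hm0 x hx).trans ((le_abs_self _).trans (by linarith))
    obtain ⟨ρ, r1, r2, r3⟩ := op_repr hA hD (LamRe hK) (k := |m0| + 1) (by positivity)
      fun f hf h0 => by
        have := main_pos hA hP hφ hK hD hm hf h0
        exact ⟨(this.2.2 hpos).1, (le_abs_self _).trans this.1⟩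
    have hz : ∀ f : ℝ → ℝ, ContinuousOn f (Set.Icc a b) → (∀ x ∈ Set.Icc a b, 0 ≤ f x) →
        Lam hK (fc (fun x => (f x : ℂ)) Y) = ∫ x in Set.Icc a b, (f x : ℂ) * (ρ x : ℂ) := by
      intro f hf h0
      have e1 := r3 f hf
      have e2 := ((main_pos hA hP hφ hK hD hm hf h0).2.2 hpos).2
      have e3 : (∫ x in Set.Icc a b, (f x : ℂ) * (ρ x : ℂ)) =
          ((∫ x in Set.Icc a b, f x * ρ x : ℝ) : ℂ) := by
        rw [← integral_complex_ofReal]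
        push_cast
        rfl
      rw [e3, ← e1]
      exact Complex.ext rfl e2
    have ρi : IntegrableOn (fun x => (ρ x : ℂ)) (Set.Icc a b) := r2.ofReal
    have hd : IntegrableOn (fun x => η x - (ρ x : ℂ)) (Set.Icc a b) := hη.sub ρi
    have hnn : ∀ f : ℝ → ℝ, ContinuousOn f (Set.Icc a b) → (∀ x ∈ Set.Icc a b, 0 ≤ f x) →
        (∫ x in Set.Icc a b, (f x : ℂ) * (η x - (ρ x : ℂ))) = 0 := by
      intro f hf h0
      have hfc : ContinuousOn (fun x => (f x : ℂ)) (Set.Icc a b) :=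
        Complex.continuous_ofReal.comp_continuousOn hf
      have e1 := (hL _ hfc).symm.trans (hz f hf h0)
      simp only [mul_sub]
      rw [integral_sub (hη.continuousOn_mul hfc isCompact_Icc)
        (ρi.continuousOn_mul hfc isCompact_Icc), e1, sub_self]
    have key := zero_of_poly hd fun p => by
      obtain ⟨M, hM⟩ := isCompact_Icc.exists_bound_of_continuousOn (s := Set.Icc a b)
        p.continuous.continuousOn
      have c1 : Continuous fun x => p.eval x + |M| := p.continuous.add continuous_const
      have q1 := hnn (fun x => p.eval x + |M|) c1.continuousOn fun x hx => by
        have := hM x hx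
        rw [Real.norm_eq_abs] at this
        linarith [neg_abs_le (p.eval x), le_abs_self M]
      have q2 := hnn (fun _ => |M|) continuousOn_const fun x hx => abs_nonneg _
      have c1' : ContinuousOn (fun x => ((p.eval x + |M| : ℝ) : ℂ)) (Set.Icc a b) :=
        (Complex.continuous_ofReal.comp c1).continuousOn
      have c2' : ContinuousOn (fun _ : ℝ => ((|M| : ℝ) : ℂ)) (Set.Icc a b) := continuousOn_const
      have q3 := integral_sub (hd.continuousOn_mul c1' isCompact_Icc)
        (hd.continuousOn_mul c2' isCompact_Icc)
      rw [q1, q2, sub_zero] at q3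
      rw [← q3]
      refine integral_congr_ae (Filter.Eventually.of_forall fun x => ?_)
      simp only [Complex.ofReal_add]
      ring
    filter_upwards [key] with x hx hxm
    have := sub_eq_zero.1 (hx hxm)
    rw [this]
    exact ⟨Complex.ofReal_im _, r1 x⟩
  · intro η' hη' hform
    have hd : IntegrableOn (fun x => η' x - η x) (Set.Icc a b) := hη'.sub hη
    have key := zero_of_poly hd fun p => by
      obtain ⟨ψ, hψ, hψd⟩ := exists_primitive a b hP p
      have hc := (P_contDiff hP hψ).2.continuousOn (s := Set.Icc a b)
      have e1 := (hform ψ hψ).symm.trans (form ψ hψ)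
      have e2 : ∫ x in Set.Icc a b, deriv ψ x * (η' x - η x) = 0 := by
        simp only [mul_sub]
        rw [integral_sub (hη'.continuousOn_mul hc isCompact_Icc)
          (hη.continuousOn_mul hc isCompact_Icc), e1, sub_self]
      rw [← e2]
      refine setIntegral_congr_fun measurableSet_Icc fun x hx => ?_
      simp only [hψd x hx]
    filter_upwards [key] with x hx hxm
    exact sub_eq_zero.1 (hx hxm)

end HHCP
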